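/- Let p > 3 be a prime and let D ∈ ℤ_p be such that either |D|_p ≤ p⁻² or the image of D − 4 in ℤ/pℤ is a nonzero square. Let G_p be the subgroup of permutations of (ℤ/pℤ)³ generated by the three Vieta involutions (x,y,z) ↦ (yz−x,y,z), (x,y,z) ↦ (x,xz−y,z), (x,y,z) ↦ (x,y,xy−z), the double sign changes (x,y,z) ↦ (x,−y,−z), (−x,y,−z), (−x,−y,z), and all permutations of the three coordinates, and let G be the subgroup of bijections of ℤ_p³ generated by the same formulas over ℤ_p. If G_p acts transitively on X_{D̄}^*(ℤ/pℤ) (where D̄ is the image of D in ℤ/pℤ), then for every point a ∈ X_D^*(ℤ_p), the orbit {γ(a) : γ ∈ G} is dense in X_D^*(ℤ_p) with respect to the sup distance; that is, G acts minimally on X_D^*(ℤ_p). -/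

import Mathlib

open Polynomial

noncomputable section

/-- The companion matrix `C(x) = [[x, -1], [1, 0]]`. -/
def cmat {R : Type*} [CommRing R] (x : R) : Matrix (Fin 2) (Fin 2) R := !![x, -1; 1, 0]

def chebTAux : ℕ → Polynomial ℤ
  | 0 => 2
  | 1 => X
  | n + 2 => X * chebTAux (n + 1) - chebTAux n

def chebUAux : ℕ → Polynomial ℤ
  | 0 => 1
  | 1 => X
  | n + 2 => X * chebUAux (n + 1) - chebUAux n

/-- The monic Chebyshev polynomial of the first kind `T_n` (`n ∈ ℤ`), defined by the
recurrence `T_n = X T_{n-1} - T_{n-2}` with `T_{-1} = X`, `T_0 = 2`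
(using the symmetry `T_{-n} = T_n`). -/
def chebT (n : ℤ) : Polynomial ℤ := chebTAux n.natAbs

/-- The monic Chebyshev polynomial of the second kind `U_n` (`n ∈ ℤ`), defined by the
recurrence `U_n = X U_{n-1} - U_{n-2}` with `U_{-1} = 0`, `U_0 = 1`
(using the symmetry `U_{-n-2} = -U_n`). -/
def chebU (n : ℤ) : Polynomial ℤ :=
  if 0 ≤ n then chebUAux n.toNat
  else if n = -1 then 0
  else -chebUAux (-(n + 2)).toNat

/-- The Vieta involution `s_x : (x, y, z) ↦ (yz - x, y, z)`. -/
def vietaSx (R : Type*) [CommRing R] : Equiv.Perm (R × R × R) :=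
  Function.Involutive.toPerm (fun v => (v.2.1 * v.2.2 - v.1, v.2.1, v.2.2)) (by
    rintro ⟨x, y, z⟩; simp)

/-- The Vieta involution `s_y : (x, y, z) ↦ (x, xz - y, z)`. -/
def vietaSy (R : Type*) [CommRing R] : Equiv.Perm (R × R × R) :=
  Function.Involutive.toPerm (fun v => (v.1, v.1 * v.2.2 - v.2.1, v.2.2)) (by
    rintro ⟨x, y, z⟩; simp)

/-- The Vieta involution `s_z : (x, y, z) ↦ (x, y, xy - z)`. -/
def vietaSz (R : Type*) [CommRing R] : Equiv.Perm (R × R × R) :=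
  Function.Involutive.toPerm (fun v => (v.1, v.2.1, v.1 * v.2.1 - v.2.2)) (by
    rintro ⟨x, y, z⟩; simp)

/-- The double sign change `(x, y, z) ↦ (x, -y, -z)`. -/
def signYZ (R : Type*) [CommRing R] : Equiv.Perm (R × R × R) :=
  Function.Involutive.toPerm (fun v => (v.1, -v.2.1, -v.2.2)) (by
    rintro ⟨x, y, z⟩; simp)

/-- The double sign change `(x, y, z) ↦ (-x, y, -z)`. -/
def signXZ (R : Type*) [CommRing R] : Equiv.Perm (R × R × R) :=
  Function.Involutive.toPerm (fun v => (-v.1, v.2.1, -v.2.2)) (by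
    rintro ⟨x, y, z⟩; simp)

/-- The double sign change `(x, y, z) ↦ (-x, -y, z)`. -/
def signXY (R : Type*) [CommRing R] : Equiv.Perm (R × R × R) :=
  Function.Involutive.toPerm (fun v => (-v.1, -v.2.1, v.2.2)) (by
    rintro ⟨x, y, z⟩; simp)

/-- The coordinate transposition `(x, y, z) ↦ (y, x, z)`. -/
def swapXY (R : Type*) [CommRing R] : Equiv.Perm (R × R × R) :=
  Function.Involutive.toPerm (fun v => (v.2.1, v.1, v.2.2)) (by
    rintro ⟨x, y, z⟩; simp)

/-- The coordinate transposition `(x, y, z) ↦ (x, z, y)`. -/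
def swapYZ (R : Type*) [CommRing R] : Equiv.Perm (R × R × R) :=
  Function.Involutive.toPerm (fun v => (v.1, v.2.2, v.2.1)) (by
    rintro ⟨x, y, z⟩; simp)

/-- The coordinate transposition `(x, y, z) ↦ (z, y, x)`. -/
def swapXZ (R : Type*) [CommRing R] : Equiv.Perm (R × R × R) :=
  Function.Involutive.toPerm (fun v => (v.2.2, v.2.1, v.1)) (by
    rintro ⟨x, y, z⟩; simp)

/-- The nonsingular locus `X_D^*(R)` of the Markoff surface
`x² + y² + z² - xyz = D`: points where one of `2x - yz`, `2y - xz`, `2z - xy` is a unit. -/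
def markoffSet (R : Type*) [CommRing R] (D : R) : Set (R × R × R) :=
  {v | v.1 ^ 2 + v.2.1 ^ 2 + v.2.2 ^ 2 - v.1 * v.2.1 * v.2.2 = D ∧
    (IsUnit (2 * v.1 - v.2.1 * v.2.2) ∨ IsUnit (2 * v.2.1 - v.1 * v.2.2) ∨
      IsUnit (2 * v.2.2 - v.1 * v.2.1))}

/-- The group `Γ` generated by the three Vieta involutions. -/
def vietaGroup (R : Type*) [CommRing R] : Subgroup (Equiv.Perm (R × R × R)) :=
  Subgroup.closure {vietaSx R, vietaSy R, vietaSz R}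

/-- The cyclic coordinate permutation `(x, y, z) ↦ (y, z, x)`. -/
def cycA (R : Type*) [CommRing R] : Equiv.Perm (R × R × R) :=
  (swapXY R).trans (swapYZ R)

/-- The cyclic coordinate permutation `(x, y, z) ↦ (z, x, y)`. -/
def cycB (R : Type*) [CommRing R] : Equiv.Perm (R × R × R) :=
  (swapYZ R).trans (swapXY R)

/-- The group generated by the Vieta involutions, the double sign changes and all
(non-identity) permutations of the three coordinates. -/
def fullAutGroup (R : Type*) [CommRing R] : Subgroup (Equiv.Perm (R × R × R)) :=
  Subgroup.closure {vietaSx R, vietaSy R, vietaSz R, signYZ R, signXZ R, signXY R,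
    swapXY R, swapYZ R, swapXZ R, cycA R, cycB R}


/-- The Lucas sequence `0, 1, x, x² - 1, …` with `u (n + 2) = x * u (n + 1) - u n`. -/
def lucasU {R : Type*} [CommRing R] (x : R) : ℕ → R
  | 0 => 0
  | 1 => 1
  | n + 2 => x * lucasU x (n + 1) - lucasU x n

/-- The companion Lucas sequence `2, x, x² - 2, …`. -/
def lucasC {R : Type*} [CommRing R] (x : R) : ℕ → R
  | 0 => 2
  | 1 => x
  | n + 2 => x * lucasC x (n + 1) - lucasC x n

/-- The derivative of `lucasU x n` with respect to `x`. -/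
def lucasV {R : Type*} [CommRing R] (x : R) : ℕ → R
  | 0 => 0
  | 1 => 0
  | n + 2 => lucasU x (n + 1) + x * lucasV x (n + 1) - lucasV x n

section Lucas

variable {R : Type*} [CommRing R]

theorem lucasC_eq (x : R) (n : ℕ) : lucasC x n = 2 * lucasU x (n + 1) - x * lucasU x n := by
  induction n using Nat.twoStepInduction with
  | zero => simp [lucasC, lucasU]
  | one => simp [lucasC, lucasU]; ring
  | more n h₁ h₂ => simp only [lucasC, lucasU] at *; rw [h₁, h₂]; ring

theorem lucasU_norm (x : R) (n : ℕ) :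
    lucasU x (n + 1) ^ 2 - x * lucasU x n * lucasU x (n + 1) + lucasU x n ^ 2 = 1 := by
  induction n with
  | zero => simp [lucasU]
  | succ n ih => simp only [lucasU] at *; linear_combination ih

theorem lucasC_sq_sub_four (x : R) (n : ℕ) :
    (lucasC x n - 2) * (lucasC x n + 2) = (x ^ 2 - 4) * lucasU x n ^ 2 := by
  rw [lucasC_eq]; linear_combination 4 * lucasU_norm x n

theorem lucasU_add_succ (x : R) (m n : ℕ) :
    lucasU x (m + n + 1) = lucasU x (m + 1) * lucasU x (n + 1) - lucasU x m * lucasU x n := by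
  induction n using Nat.twoStepInduction with
  | zero => simp [lucasU]
  | one => simp [lucasU]; ring
  | more n h₁ h₂ =>
    have e : lucasU x (m + (n + 2) + 1) = x * lucasU x (m + (n + 1) + 1) - lucasU x (m + n + 1) := rfl
    rw [e, h₁, h₂]; simp only [lucasU]; ring

theorem lucasU_add_two_mul (x : R) (a n : ℕ) :
    lucasU x (a + 2 * n) = lucasC x n * lucasU x (a + n) - lucasU x a := by
  induction a using Nat.twoStepInduction with
  | zero =>
    cases n with
    | zero => simp [lucasU]
    | succ n =>
      have h := lucasU_add_succ x (n + 1) n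
      rw [show 0 + 2 * (n + 1) = n + 1 + n + 1 by ring, h, lucasC_eq, zero_add]
      simp only [lucasU]; ring
  | one =>
    have h := lucasU_add_succ x n n
    rw [show 1 + 2 * n = n + n + 1 by ring, h, lucasC_eq, add_comm 1 n]
    simp only [lucasU]
    linear_combination - lucasU_norm x n
  | more a h₁ h₂ =>
    have e₁ : lucasU x (a + 2 + 2 * n) = x * lucasU x (a + 1 + 2 * n) - lucasU x (a + 2 * n) := by
      rw [show a + 2 + 2 * n = (a + 2 * n) + 2 by ring, show a + 1 + 2 * n = (a + 2 * n) + 1 by ring]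
      rfl
    have e₂ : lucasU x (a + 2 + n) = x * lucasU x (a + 1 + n) - lucasU x (a + n) := by
      rw [show a + 2 + n = (a + n) + 2 by ring, show a + 1 + n = (a + n) + 1 by ring]
      rfl
    rw [e₁, e₂, h₁, h₂]; simp only [lucasU]; ring

theorem lucasC_add_two_mul (x : R) (a n : ℕ) :
    lucasC x (a + 2 * n) = lucasC x n * lucasC x (a + n) - lucasC x a := by
  have h₁ := lucasU_add_two_mul x a n
  have h₂ := lucasU_add_two_mul x (a + 1) n
  rw [lucasC_eq x (a + 2 * n), lucasC_eq x (a + n), lucasC_eq x a,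
    show a + 2 * n + 1 = a + 1 + 2 * n by ring, show a + n + 1 = a + 1 + n by ring, h₁, h₂]
  ring

theorem lucasU_mul (x : R) (m n : ℕ) :
    lucasU x (m * n) = lucasU x n * lucasU (lucasC x n) m := by
  induction m using Nat.twoStepInduction with
  | zero => simp [lucasU]
  | one => simp [lucasU]
  | more m h₁ h₂ =>
    rw [show (m + 2) * n = m * n + 2 * n by ring, lucasU_add_two_mul,
      show m * n + n = (m + 1) * n by ring, h₁, h₂]
    simp only [lucasU]; ring

theorem lucasC_mul (x : R) (m n : ℕ) : lucasC x (m * n) = lucasC (lucasC x n) m := by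
  induction m using Nat.twoStepInduction with
  | zero => simp [lucasC]
  | one => simp [lucasC]
  | more m h₁ h₂ =>
    rw [show (m + 2) * n = m * n + 2 * n by ring, lucasC_add_two_mul,
      show m * n + n = (m + 1) * n by ring, h₁, h₂]
    simp only [lucasC]

theorem lucasU_two (n : ℕ) : lucasU (2 : R) n = n := by
  induction n using Nat.twoStepInduction with
  | zero => simp [lucasU]
  | one => simp [lucasU]
  | more n h₁ h₂ => simp only [lucasU]; rw [h₁, h₂]; push_cast; ring

theorem lucasC_two (n : ℕ) : lucasC (2 : R) n = 2 := by
  induction n using Nat.twoStepInduction with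
  | zero => simp [lucasC]
  | one => simp [lucasC]
  | more n h₁ h₂ => simp only [lucasC]; rw [h₁, h₂]; ring

theorem lucasV_two (n : ℕ) : 6 * lucasV (2 : R) n = n * (n ^ 2 - 1) := by
  induction n using Nat.twoStepInduction with
  | zero => simp [lucasV]
  | one => simp [lucasV]
  | more n h₁ h₂ =>
    simp only [lucasV, lucasU_two]; push_cast at *
    linear_combination 2 * h₂ - h₁

theorem lucasV_eq (x : R) (n : ℕ) :
    (x ^ 2 - 4) * lucasV x n = n * lucasC x n - x * lucasU x n := by
  induction n using Nat.twoStepInduction with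
  | zero => simp [lucasV, lucasU]
  | one => simp [lucasV, lucasU, lucasC]
  | more n h₁ h₂ =>
    have h := lucasC_eq x n
    have h' := lucasC_eq x (n + 1)
    simp only [lucasV, lucasU, lucasC] at *
    push_cast at *
    rw [h'] at h₂ ⊢
    rw [h] at h₁ ⊢
    linear_combination x * h₂ - h₁

theorem lucasU_taylor (x h : R) (n : ℕ) :
    h ^ 2 ∣ lucasU (x + h) n - lucasU x n - h * lucasV x n := by
  induction n using Nat.twoStepInduction with
  | zero => simp [lucasU, lucasV]
  | one => simp [lucasU, lucasV]
  | more n h₁ h₂ =>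
    obtain ⟨a, ha⟩ := h₁
    obtain ⟨b, hb⟩ := h₂
    simp only [lucasU, lucasV]
    exact ⟨(x + h) * b - a + lucasV x (n + 1), by linear_combination (x + h) * hb - ha⟩

theorem sub_dvd_lucasU_sub (x y : R) (n : ℕ) : x - y ∣ lucasU x n - lucasU y n := by
  induction n using Nat.twoStepInduction with
  | zero => simp [lucasU]
  | one => simp [lucasU]
  | more n h₁ h₂ =>
    obtain ⟨a, ha⟩ := h₁
    obtain ⟨b, hb⟩ := h₂
    simp only [lucasU]
    exact ⟨x * b - a + lucasU y (n + 1), by linear_combination x * hb - ha⟩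

theorem sub_dvd_lucasC_sub (x y : R) (n : ℕ) : x - y ∣ lucasC x n - lucasC y n := by
  induction n using Nat.twoStepInduction with
  | zero => simp [lucasC]
  | one => simp [lucasC]
  | more n h₁ h₂ =>
    obtain ⟨a, ha⟩ := h₁
    obtain ⟨b, hb⟩ := h₂
    simp only [lucasC]
    exact ⟨x * b - a + lucasC y (n + 1), by linear_combination x * hb - ha⟩

theorem map_lucasU {S : Type*} [CommRing S] (f : R →+* S) (x : R) (n : ℕ) :
    f (lucasU x n) = lucasU (f x) n := by
  induction n using Nat.twoStepInduction with
  | zero => simp [lucasU]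
  | one => simp [lucasU]
  | more n h₁ h₂ => simp only [lucasU]; rw [map_sub, map_mul, h₁, h₂]

theorem map_lucasC {S : Type*} [CommRing S] (f : R →+* S) (x : R) (n : ℕ) :
    f (lucasC x n) = lucasC (f x) n := by
  induction n using Nat.twoStepInduction with
  | zero => simp only [lucasC, map_ofNat]
  | one => simp [lucasC]
  | more n h₁ h₂ => simp only [lucasC]; rw [map_sub, map_mul, h₁, h₂]

theorem lucasU_of_mul_eq_one {t s : R} (h : t * s = 1) (n : ℕ) :
    lucasU (t + s) n * (t - s) = t ^ n - s ^ n := by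
  induction n using Nat.twoStepInduction with
  | zero => simp [lucasU]
  | one => simp [lucasU]
  | more n h₁ h₂ =>
    simp only [lucasU]
    linear_combination (t + s) * h₂ - h₁ + (t ^ n - s ^ n) * h

theorem lucasC_eq_eval_dickson (x : R) (n : ℕ) : lucasC x n = (dickson 1 (1 : R) n).eval x := by
  induction n using Nat.twoStepInduction with
  | zero => simp [lucasC]; norm_num
  | one => simp [lucasC]
  | more n h₁ h₂ => simp [lucasC, dickson_add_two, h₁, h₂]

end Lucas

/-- In characteristic `p`, the companion matrix of a polynomial `X² - x X + 1` with distinct roots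
has order dividing `p² - 1`. -/
theorem lucas_prime_sq_sub_one {p : ℕ} [Fact p.Prime] (hp : 3 < p) {x : ZMod p}
    (hx : x ^ 2 - 4 ≠ 0) :
    lucasU x (p ^ 2 - 1) = 0 ∧ lucasC x (p ^ 2 - 1) = 2 := by
  have h2 : (2 : ZMod p) ≠ 0 := by
    intro h
    have : ((2 : ℕ) : ZMod p) = 0 := by exact_mod_cast h
    rw [ZMod.natCast_eq_zero_iff] at this
    exact absurd (Nat.le_of_dvd (by norm_num) this) (by omega)
  have hc : lucasC x p = x := by
    rw [lucasC_eq_eval_dickson, dickson_one_one_zmod_p]; simp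
  have hu : (lucasU x p - 1) * (lucasU x p + 1) = 0 := by
    have h := lucasC_sq_sub_four x p
    rw [hc] at h
    refine mul_left_cancel₀ hx ?_
    linear_combination - h
  have h1 : lucasC x (p + 1) * 2 = x * x + (x ^ 2 - 4) * lucasU x p := by
    have h' := lucasC_eq x p
    rw [hc] at h'
    rw [lucasC_eq x (p + 1)]
    simp only [lucasU]
    linear_combination -x * h'
  obtain ⟨q, rfl⟩ : ∃ q, p = q + 1 := ⟨p - 1, by omega⟩
  have h3 : lucasC x (q + 1 + 1) = x * lucasC x (q + 1) - lucasC x q := rfl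
  have hC : lucasC x ((q + 1) ^ 2 - 1) = 2 := by
    have e : (q + 1) ^ 2 - 1 = (q + 2) * q := by
      rw [show (q + 1) ^ 2 = (q + 2) * q + 1 by ring]; simp
    rcases mul_eq_zero.mp hu with h | h
    · have : lucasC x q = 2 := by
        rw [hc] at h3
        refine mul_right_cancel₀ h2 ?_
        linear_combination 2 * h3 - h1 - (x ^ 2 - 4) * h
      rw [e, lucasC_mul, this, lucasC_two]
    · have : lucasC x (q + 2) = 2 := by
        refine mul_right_cancel₀ h2 ?_
        linear_combination h1 + (x ^ 2 - 4) * h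
      rw [e, mul_comm, lucasC_mul, this, lucasC_two]
  refine ⟨?_, hC⟩
  have h := lucasC_sq_sub_four x ((q + 1) ^ 2 - 1)
  rw [hC, sub_self, zero_mul] at h
  rcases mul_eq_zero.mp h.symm with h | h
  · exact absurd h hx
  · exact pow_eq_zero_iff (two_ne_zero) |>.mp h

/-- Coordinatewise action of a map on triples. -/
def mapTriple {R S : Type*} (f : R → S) (v : R × R × R) : S × S × S := (f v.1, f v.2.1, f v.2.2)

section Group

variable {R S : Type*} [CommRing R] [CommRing S]

theorem vietaSx_apply (x y z : R) : vietaSx R (x, y, z) = (y * z - x, y, z) := rfl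

theorem vietaSy_apply (x y z : R) : vietaSy R (x, y, z) = (x, x * z - y, z) := rfl

theorem vietaSz_apply (x y z : R) : vietaSz R (x, y, z) = (x, y, x * y - z) := rfl

theorem signYZ_apply (x y z : R) : signYZ R (x, y, z) = (x, -y, -z) := rfl

theorem signXZ_apply (x y z : R) : signXZ R (x, y, z) = (-x, y, -z) := rfl

theorem signXY_apply (x y z : R) : signXY R (x, y, z) = (-x, -y, z) := rfl

theorem swapXY_apply (x y z : R) : swapXY R (x, y, z) = (y, x, z) := rfl

theorem swapYZ_apply (x y z : R) : swapYZ R (x, y, z) = (x, z, y) := rfl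

theorem swapXZ_apply (x y z : R) : swapXZ R (x, y, z) = (z, y, x) := rfl

theorem cycA_apply (x y z : R) : cycA R (x, y, z) = (y, z, x) := rfl

theorem cycB_apply (x y z : R) : cycB R (x, y, z) = (z, x, y) := rfl

theorem exists_fullAutGroup_map (f : R →+* S) {γ : Equiv.Perm (R × R × R)}
    (hγ : γ ∈ fullAutGroup R) :
    ∃ δ ∈ fullAutGroup S, ∀ v, mapTriple f (γ v) = δ (mapTriple f v) := by
  induction hγ using Subgroup.closure_induction with
  | mem γ h =>
    simp only [Set.mem_insert_iff, Set.mem_singleton_iff] at h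
    rcases h with rfl | rfl | rfl | rfl | rfl | rfl | rfl | rfl | rfl | rfl | rfl
    on_goal 1 => refine ⟨vietaSx S, Subgroup.subset_closure (by simp), ?_⟩
    on_goal 2 => refine ⟨vietaSy S, Subgroup.subset_closure (by simp), ?_⟩
    on_goal 3 => refine ⟨vietaSz S, Subgroup.subset_closure (by simp), ?_⟩
    on_goal 4 => refine ⟨signYZ S, Subgroup.subset_closure (by simp), ?_⟩
    on_goal 5 => refine ⟨signXZ S, Subgroup.subset_closure (by simp), ?_⟩
    on_goal 6 => refine ⟨signXY S, Subgroup.subset_closure (by simp), ?_⟩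
    on_goal 7 => refine ⟨swapXY S, Subgroup.subset_closure (by simp), ?_⟩
    on_goal 8 => refine ⟨swapYZ S, Subgroup.subset_closure (by simp), ?_⟩
    on_goal 9 => refine ⟨swapXZ S, Subgroup.subset_closure (by simp), ?_⟩
    on_goal 10 => refine ⟨cycA S, Subgroup.subset_closure (by simp), ?_⟩
    on_goal 11 => refine ⟨cycB S, Subgroup.subset_closure (by simp), ?_⟩
    all_goals
      rintro ⟨x, y, z⟩
      simp [mapTriple, vietaSx_apply, vietaSy_apply, vietaSz_apply, signYZ_apply, signXZ_apply,
        signXY_apply, swapXY_apply, swapYZ_apply, swapXZ_apply, cycA_apply, cycB_apply]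
  | one => exact ⟨1, one_mem _, fun v => rfl⟩
  | mul γ₁ γ₂ _ _ h₁ h₂ =>
    obtain ⟨δ₁, m₁, e₁⟩ := h₁
    obtain ⟨δ₂, m₂, e₂⟩ := h₂
    exact ⟨δ₁ * δ₂, mul_mem m₁ m₂, fun v => by simp [e₁, e₂]⟩
  | inv γ _ h =>
    obtain ⟨δ, m, e⟩ := h
    exact ⟨δ⁻¹, inv_mem m, fun v => by rw [Equiv.Perm.eq_inv_iff_eq, ← e]; simp⟩

theorem exists_fullAutGroup_lift (f : R →+* S) {δ : Equiv.Perm (S × S × S)}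
    (hδ : δ ∈ fullAutGroup S) :
    ∃ γ ∈ fullAutGroup R, ∀ v, mapTriple f (γ v) = δ (mapTriple f v) := by
  induction hδ using Subgroup.closure_induction with
  | mem δ h =>
    simp only [Set.mem_insert_iff, Set.mem_singleton_iff] at h
    rcases h with rfl | rfl | rfl | rfl | rfl | rfl | rfl | rfl | rfl | rfl | rfl
    on_goal 1 => refine ⟨vietaSx R, Subgroup.subset_closure (by simp), ?_⟩
    on_goal 2 => refine ⟨vietaSy R, Subgroup.subset_closure (by simp), ?_⟩
    on_goal 3 => refine ⟨vietaSz R, Subgroup.subset_closure (by simp), ?_⟩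
    on_goal 4 => refine ⟨signYZ R, Subgroup.subset_closure (by simp), ?_⟩
    on_goal 5 => refine ⟨signXZ R, Subgroup.subset_closure (by simp), ?_⟩
    on_goal 6 => refine ⟨signXY R, Subgroup.subset_closure (by simp), ?_⟩
    on_goal 7 => refine ⟨swapXY R, Subgroup.subset_closure (by simp), ?_⟩
    on_goal 8 => refine ⟨swapYZ R, Subgroup.subset_closure (by simp), ?_⟩
    on_goal 9 => refine ⟨swapXZ R, Subgroup.subset_closure (by simp), ?_⟩
    on_goal 10 => refine ⟨cycA R, Subgroup.subset_closure (by simp), ?_⟩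
    on_goal 11 => refine ⟨cycB R, Subgroup.subset_closure (by simp), ?_⟩
    all_goals
      rintro ⟨x, y, z⟩
      simp [mapTriple, vietaSx_apply, vietaSy_apply, vietaSz_apply, signYZ_apply, signXZ_apply,
        signXY_apply, swapXY_apply, swapYZ_apply, swapXZ_apply, cycA_apply, cycB_apply]
  | one => exact ⟨1, one_mem _, fun v => rfl⟩
  | mul δ₁ δ₂ _ _ h₁ h₂ =>
    obtain ⟨γ₁, m₁, e₁⟩ := h₁
    obtain ⟨γ₂, m₂, e₂⟩ := h₂
    exact ⟨γ₁ * γ₂, mul_mem m₁ m₂, fun v => by simp [e₁, e₂]⟩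
  | inv δ _ h =>
    obtain ⟨γ, m, e⟩ := h
    exact ⟨γ⁻¹, inv_mem m, fun v => by rw [Equiv.Perm.eq_inv_iff_eq, ← e]; simp⟩

/-- The Markoff polynomial `x² + y² + z² - x y z`. -/
def markoffPoly (v : R × R × R) : R :=
  v.1 ^ 2 + v.2.1 ^ 2 + v.2.2 ^ 2 - v.1 * v.2.1 * v.2.2

theorem markoffPoly_fullAutGroup {γ : Equiv.Perm (R × R × R)} (hγ : γ ∈ fullAutGroup R)
    (v : R × R × R) : markoffPoly (γ v) = markoffPoly v := by
  induction hγ using Subgroup.closure_induction generalizing v with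
  | mem γ h =>
    simp only [Set.mem_insert_iff, Set.mem_singleton_iff] at h
    obtain ⟨x, y, z⟩ := v
    rcases h with rfl | rfl | rfl | rfl | rfl | rfl | rfl | rfl | rfl | rfl | rfl <;>
      simp only [markoffPoly, vietaSx_apply, vietaSy_apply, vietaSz_apply, signYZ_apply,
        signXZ_apply, signXY_apply, swapXY_apply, swapYZ_apply, swapXZ_apply, cycA_apply,
        cycB_apply] <;> ring
  | one => rfl
  | mul γ₁ γ₂ _ _ h₁ h₂ => rw [Equiv.Perm.mul_apply, h₁, h₂]
  | inv γ _ h => simpa using (h (γ⁻¹ v)).symm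

/-- Coordinatewise congruence of triples modulo `q`. -/
def TripleCong (q : R) (u v : R × R × R) : Prop :=
  q ∣ u.1 - v.1 ∧ q ∣ u.2.1 - v.2.1 ∧ q ∣ u.2.2 - v.2.2

theorem TripleCong.trans {q : R} {u v w : R × R × R} (h₁ : TripleCong q u v)
    (h₂ : TripleCong q v w) : TripleCong q u w :=
  ⟨by simpa using dvd_add h₁.1 h₂.1, by simpa using dvd_add h₁.2.1 h₂.2.1,
    by simpa using dvd_add h₁.2.2 h₂.2.2⟩

theorem TripleCong.symm {q : R} {u v : R × R × R} (h : TripleCong q u v) : TripleCong q v u :=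
  ⟨by simpa using (dvd_neg.mpr h.1), by simpa using (dvd_neg.mpr h.2.1),
    by simpa using (dvd_neg.mpr h.2.2)⟩

theorem TripleCong.of_dvd {q r : R} (hqr : q ∣ r) {u v : R × R × R} (h : TripleCong r u v) :
    TripleCong q u v :=
  ⟨hqr.trans h.1, hqr.trans h.2.1, hqr.trans h.2.2⟩

theorem tripleCong_iff_mapTriple_eq {q : R} {u v : R × R × R} :
    TripleCong q u v ↔ mapTriple (Ideal.Quotient.mk (Ideal.span {q})) u =
      mapTriple (Ideal.Quotient.mk (Ideal.span {q})) v := by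
  simp [TripleCong, mapTriple, Ideal.Quotient.eq, Ideal.mem_span_singleton]

theorem TripleCong.apply {q : R} {u v : R × R × R} (h : TripleCong q u v)
    {γ : Equiv.Perm (R × R × R)} (hγ : γ ∈ fullAutGroup R) : TripleCong q (γ u) (γ v) := by
  obtain ⟨δ, -, e⟩ := exists_fullAutGroup_map (Ideal.Quotient.mk (Ideal.span {q})) hγ
  rw [tripleCong_iff_mapTriple_eq] at h ⊢
  rw [e, e, h]

theorem exists_fullAutGroup_rotate (x : R) (n : ℕ) :
    ∃ γ ∈ fullAutGroup R, ∀ y z : R, (γ (x, y, z)).1 = x ∧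
      2 * (γ (x, y, z)).2.1 = lucasC x n * y + lucasU x n * (2 * z - x * y) ∧
      2 * (γ (x, y, z)).2.2 = lucasC x n * z + lucasU x n * (x * z - 2 * y) := by
  refine ⟨(swapYZ R * vietaSy R) ^ n, pow_mem (mul_mem (Subgroup.subset_closure (by simp))
    (Subgroup.subset_closure (by simp))) _, fun y z => ?_⟩
  have key : ((swapYZ R * vietaSy R) ^ n) (x, y, z) =
      (x, lucasU x (n + 1) * y + lucasU x n * (z - x * y),
        lucasU x (n + 2) * y + lucasU x (n + 1) * (z - x * y)) := by
    induction n with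
    | zero => simp [lucasU]
    | succ n ih =>
      rw [pow_succ', Equiv.Perm.mul_apply, ih]
      simp only [Equiv.Perm.mul_apply, vietaSy_apply, swapYZ_apply, lucasU]
      refine Prod.ext rfl (Prod.ext ?_ ?_) <;> ring
  rw [key, lucasC_eq]
  refine ⟨rfl, ?_, ?_⟩ <;> (simp only [lucasU]; ring)

end Group

section PadicLucas

variable {p : ℕ} [Fact p.Prime]

theorem prime_dvd_iff_toZMod_eq_zero (a : ℤ_[p]) : (p : ℤ_[p]) ∣ a ↔ PadicInt.toZMod a = 0 := by
  rw [← Ideal.mem_span_singleton, ← PadicInt.maximalIdeal_eq_span_p, ← PadicInt.ker_toZMod,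
    RingHom.mem_ker]

theorem isUnit_iff_toZMod_ne_zero (a : ℤ_[p]) : IsUnit a ↔ PadicInt.toZMod a ≠ 0 := by
  rw [Ne, ← RingHom.mem_ker, PadicInt.ker_toZMod, IsLocalRing.mem_maximalIdeal, mem_nonunits_iff,
    not_not]

theorem prime_dvd_sub_iff (a b : ℤ_[p]) :
    (p : ℤ_[p]) ∣ a - b ↔ PadicInt.toZMod a = PadicInt.toZMod b := by
  rw [prime_dvd_iff_toZMod_eq_zero, map_sub, sub_eq_zero]

theorem natCast_zmod_ne_zero_of_lt {n : ℕ} (h0 : 0 < n) (h : n < p) : (n : ZMod p) ≠ 0 := by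
  rw [Ne, ZMod.natCast_eq_zero_iff]
  exact Nat.not_dvd_of_pos_of_lt h0 h

theorem two_ne_zero_zmod (hp : 3 < p) : (2 : ZMod p) ≠ 0 := by
  exact_mod_cast natCast_zmod_ne_zero_of_lt (p := p) (n := 2) (by omega) (by omega)

theorem three_ne_zero_zmod (hp : 3 < p) : (3 : ZMod p) ≠ 0 := by
  exact_mod_cast natCast_zmod_ne_zero_of_lt (p := p) (n := 3) (by omega) (by omega)

theorem isUnit_two (hp : 3 < p) : IsUnit (2 : ℤ_[p]) := by
  rw [isUnit_iff_toZMod_ne_zero, map_ofNat]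
  exact two_ne_zero_zmod hp

theorem isUnit_six (hp : 3 < p) : IsUnit (6 : ℤ_[p]) := by
  rw [isUnit_iff_toZMod_ne_zero, map_ofNat]
  have h : (6 : ZMod p) = 2 * 3 := by norm_num
  rw [h]
  exact mul_ne_zero (two_ne_zero_zmod hp) (three_ne_zero_zmod hp)

theorem isUnit_one_add_prime_mul (a : ℤ_[p]) : IsUnit (1 + p * a) := by
  rw [isUnit_iff_toZMod_ne_zero]
  simp

theorem lucasU_prime_near_two (hp : 3 < p) {h : ℤ_[p]} (hh : (p : ℤ_[p]) ∣ h) :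
    ∃ m, IsUnit m ∧ lucasU (2 + h) p = p * m := by
  have hV : (p : ℤ_[p]) ∣ lucasV 2 p := by
    rw [← (isUnit_six hp).dvd_mul_left, lucasV_two]
    exact dvd_mul_right _ _
  obtain ⟨w, hw⟩ := lucasU_taylor (2 : ℤ_[p]) h p
  obtain ⟨v, hv⟩ := hV
  obtain ⟨g, rfl⟩ := hh
  refine ⟨1 + p * (g * v + g ^ 2 * w), isUnit_one_add_prime_mul _, ?_⟩
  rw [lucasU_two, hv] at hw
  linear_combination hw

/-- Some iterate of the Lucas rotation with trace `x` is congruent to the identity modulo `p`,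
but not modulo `p ^ 2`. -/
def GoodTrace (x : ℤ_[p]) : Prop :=
  ∃ k m, IsUnit m ∧ lucasU x k = p * m ∧ (p : ℤ_[p]) ∣ lucasC x k - 2

theorem GoodTrace.exists_lucasU_eq_pow (hp : 3 < p) {x : ℤ_[p]} (hx : GoodTrace x) (n : ℕ) :
    ∃ k m, IsUnit m ∧ lucasU x k = p ^ (n + 1) * m ∧ (p : ℤ_[p]) ∣ lucasC x k - 2 := by
  induction n with
  | zero => simpa [GoodTrace] using hx
  | succ n ih =>
    obtain ⟨k, m, hm, hu, hc⟩ := ih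
    obtain ⟨m', hm', hu'⟩ := lucasU_prime_near_two hp hc
    rw [add_sub_cancel] at hu'
    refine ⟨p * k, m * m', hm.mul hm', ?_, ?_⟩
    · rw [lucasU_mul, hu, hu']
      ring
    · rw [lucasC_mul]
      have := sub_dvd_lucasC_sub (lucasC x k) 2 p
      rw [lucasC_two] at this
      exact hc.trans this

theorem GoodTrace.exists_lucas_near (hp : 3 < p) {x : ℤ_[p]} (hx : GoodTrace x) (n : ℕ)
    (s : ℤ_[p]) :
    ∃ K, (p : ℤ_[p]) ^ (n + 2) ∣ lucasU x K - p ^ (n + 1) * s ∧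
      (p : ℤ_[p]) ^ (n + 2) ∣ lucasC x K - 2 := by
  obtain ⟨k, m, hm, hu, hc⟩ := hx.exists_lucasU_eq_pow hp n
  set j : ℕ := (PadicInt.toZMod s * (PadicInt.toZMod m)⁻¹).val with hj
  have hjm : (p : ℤ_[p]) ∣ j * m - s := by
    rw [prime_dvd_sub_iff, map_mul, map_natCast, hj, ZMod.natCast_zmod_val,
      inv_mul_cancel_right₀ ((isUnit_iff_toZMod_ne_zero m).mp hm)]
  have hju : (p : ℤ_[p]) ∣ lucasU (lucasC x k) j - j := by
    have := sub_dvd_lucasU_sub (lucasC x k) 2 j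
    rw [lucasU_two] at this
    exact hc.trans this
  have hjc : (p : ℤ_[p]) ∣ lucasC x (j * k) - 2 := by
    have := sub_dvd_lucasC_sub (lucasC x k) 2 j
    rw [lucasC_two, ← lucasC_mul] at this
    exact hc.trans this
  refine ⟨j * k, ?_, ?_⟩
  · obtain ⟨a, ha⟩ := hjm
    obtain ⟨b, hb⟩ := hju
    refine ⟨a + m * b, ?_⟩
    rw [lucasU_mul, hu]
    linear_combination p ^ (n + 1) * ha + p ^ (n + 1) * m * hb
  · have hunit : IsUnit (lucasC x (j * k) + 2) := by
      rw [prime_dvd_sub_iff] at hjc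
      rw [isUnit_iff_toZMod_ne_zero, map_add, hjc, map_ofNat]
      have h : (2 + 2 : ZMod p) = 2 * 2 := by norm_num
      rw [h]
      exact mul_ne_zero (two_ne_zero_zmod hp) (two_ne_zero_zmod hp)
    rw [← hunit.dvd_mul_right, lucasC_sq_sub_four, lucasU_mul, hu]
    exact ⟨(x ^ 2 - 4) * p ^ n * m ^ 2 * lucasU (lucasC x k) j ^ 2, by ring⟩

theorem goodTrace_of_dvd_sub_two (hp : 3 < p) {x : ℤ_[p]} (hx : (p : ℤ_[p]) ∣ x - 2) :
    GoodTrace x := by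
  obtain ⟨m, hm, hu⟩ := lucasU_prime_near_two hp hx
  rw [add_sub_cancel] at hu
  refine ⟨p, m, hm, hu, ?_⟩
  have := sub_dvd_lucasC_sub x 2 p
  rw [lucasC_two] at this
  exact hx.trans this

/-- The Lucas rotation with trace `x` already has order dividing `p ^ 2 - 1` modulo `p ^ 2`. -/
def BadTrace (x : ℤ_[p]) : Prop := (p : ℤ_[p]) ^ 2 ∣ lucasU x (p ^ 2 - 1)

theorem lucas_sq_sub_one_cong (hp : 3 < p) {x : ℤ_[p]} (hx : IsUnit (x ^ 2 - 4)) :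
    (p : ℤ_[p]) ∣ lucasU x (p ^ 2 - 1) ∧ (p : ℤ_[p]) ∣ lucasC x (p ^ 2 - 1) - 2 := by
  rw [isUnit_iff_toZMod_ne_zero, map_sub, map_pow, map_ofNat] at hx
  obtain ⟨h₁, h₂⟩ := lucas_prime_sq_sub_one hp hx
  rw [prime_dvd_sub_iff, prime_dvd_iff_toZMod_eq_zero, map_lucasU, map_lucasC, h₁, h₂, map_ofNat]
  exact ⟨rfl, rfl⟩

theorem goodTrace_of_not_badTrace (hp : 3 < p) {x : ℤ_[p]} (hx : IsUnit (x ^ 2 - 4))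
    (hb : ¬BadTrace x) : GoodTrace x := by
  obtain ⟨⟨m, hm⟩, hc⟩ := lucas_sq_sub_one_cong hp hx
  refine ⟨p ^ 2 - 1, m, ?_, hm, hc⟩
  rw [isUnit_iff_toZMod_ne_zero, Ne, ← prime_dvd_iff_toZMod_eq_zero]
  rintro ⟨w, rfl⟩
  exact hb ⟨w, by rw [hm]; ring⟩

theorem BadTrace.of_dvd_sub {x y : ℤ_[p]} (hx : BadTrace x) (h : (p : ℤ_[p]) ^ 2 ∣ x - y) :
    BadTrace y := by
  have h₁ := h.trans (sub_dvd_lucasU_sub x y (p ^ 2 - 1))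
  simpa [BadTrace] using dvd_sub hx h₁

theorem isUnit_natCast_sq_sub_one : IsUnit (((p ^ 2 - 1 : ℕ) : ℤ_[p])) := by
  have h1 : 1 ≤ p ^ 2 := Nat.one_le_pow _ _ (Fact.out : p.Prime).pos
  rw [isUnit_iff_toZMod_ne_zero, map_natCast, Nat.cast_sub h1]
  simp

theorem BadTrace.sq_dvd_sub (hp : 3 < p) {x y : ℤ_[p]} (hx : BadTrace x) (hy : BadTrace y)
    (hu : IsUnit (x ^ 2 - 4)) (h : (p : ℤ_[p]) ∣ y - x) : (p : ℤ_[p]) ^ 2 ∣ y - x := by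
  obtain ⟨hU, hC⟩ := lucas_sq_sub_one_cong hp hu
  have hV : IsUnit (lucasV x (p ^ 2 - 1)) := by
    have hprod : IsUnit ((x ^ 2 - 4) * lucasV x (p ^ 2 - 1)) := by
      rw [prime_dvd_sub_iff, map_ofNat] at hC
      rw [prime_dvd_iff_toZMod_eq_zero] at hU
      rw [lucasV_eq, isUnit_iff_toZMod_ne_zero, map_sub, map_mul, map_mul, hC, hU, mul_zero,
        sub_zero]
      exact mul_ne_zero ((isUnit_iff_toZMod_ne_zero _).mp isUnit_natCast_sq_sub_one)
        (two_ne_zero_zmod hp)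
    exact isUnit_of_mul_isUnit_right hprod
  have ht := lucasU_taylor x (y - x) (p ^ 2 - 1)
  rw [add_sub_cancel] at ht
  rw [← hV.dvd_mul_right]
  have := dvd_sub (dvd_sub hy hx) ((pow_dvd_pow_of_dvd h 2).trans ht)
  simpa using this

end PadicLucas

section Moves

variable {p : ℕ} [Fact p.Prime]

theorem exists_fullAutGroup_shift (hp : 3 < p) {x : ℤ_[p]} (hx : GoodTrace x) (n : ℕ)
    (s : ℤ_[p]) :
    ∃ γ ∈ fullAutGroup ℤ_[p], ∀ y z : ℤ_[p], (γ (x, y, z)).1 = x ∧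
      (p : ℤ_[p]) ^ (n + 2) ∣ (γ (x, y, z)).2.1 - (y + p ^ (n + 1) * s * (2 * z - x * y)) ∧
      (p : ℤ_[p]) ^ (n + 2) ∣ (γ (x, y, z)).2.2 - (z + p ^ (n + 1) * s * (x * z - 2 * y)) := by
  obtain ⟨K, ⟨u, hu⟩, ⟨c, hc⟩⟩ := hx.exists_lucas_near hp n (2 * s)
  obtain ⟨γ, hγ, h⟩ := exists_fullAutGroup_rotate x K
  refine ⟨γ, hγ, fun y z => ⟨(h y z).1, ?_, ?_⟩⟩
  · rw [← (isUnit_two hp).dvd_mul_left]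
    refine ⟨c * y + u * (2 * z - x * y), ?_⟩
    linear_combination (h y z).2.1 + y * hc + (2 * z - x * y) * hu
  · rw [← (isUnit_two hp).dvd_mul_left]
    refine ⟨c * z + u * (x * z - 2 * y), ?_⟩
    linear_combination (h y z).2.2 + z * hc + (x * z - 2 * y) * hu

/-- Adjust the second coordinate, keeping the first one. -/
theorem exists_adjust_snd_fix_fst (hp : 3 < p) {x y z : ℤ_[p]} (hx : GoodTrace x)
    (hu : IsUnit (2 * z - x * y)) {n : ℕ} {y' : ℤ_[p]} (hy : (p : ℤ_[p]) ^ (n + 1) ∣ y' - y) :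
    ∃ γ ∈ fullAutGroup ℤ_[p], (γ (x, y, z)).1 = x ∧
      (p : ℤ_[p]) ^ (n + 2) ∣ (γ (x, y, z)).2.1 - y' ∧
      (p : ℤ_[p]) ^ (n + 1) ∣ (γ (x, y, z)).2.2 - z := by
  obtain ⟨e, he⟩ := hy
  obtain ⟨w, hw⟩ := hu.exists_left_inv
  obtain ⟨γ, hγ, h⟩ := exists_fullAutGroup_shift hp hx n (e * w)
  obtain ⟨h₁, ⟨b, h₂⟩, ⟨c, h₃⟩⟩ := h y z
  refine ⟨γ, hγ, h₁, ⟨b, ?_⟩, ⟨p * c + e * w * (x * z - 2 * y), ?_⟩⟩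
  · linear_combination h₂ - he + p ^ (n + 1) * e * hw
  · linear_combination h₃

/-- Adjust the third coordinate near a critical point of the second one, keeping the others. -/
theorem exists_adjust_trd_fix_fst (hp : 3 < p) {x y z : ℤ_[p]} (hx : GoodTrace x)
    (hd : (p : ℤ_[p]) ∣ 2 * z - x * y) (hu : IsUnit (2 * y - x * z)) {n : ℕ} {z' : ℤ_[p]}
    (hz : (p : ℤ_[p]) ^ (n + 1) ∣ z' - z) :
    ∃ γ ∈ fullAutGroup ℤ_[p], (γ (x, y, z)).1 = x ∧
      (p : ℤ_[p]) ^ (n + 2) ∣ (γ (x, y, z)).2.1 - y ∧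
      (p : ℤ_[p]) ^ (n + 2) ∣ (γ (x, y, z)).2.2 - z' := by
  obtain ⟨e, he⟩ := hz
  obtain ⟨d, hd⟩ := hd
  obtain ⟨w, hw⟩ := hu.exists_left_inv
  obtain ⟨γ, hγ, h⟩ := exists_fullAutGroup_shift hp hx n (-(e * w))
  obtain ⟨h₁, ⟨b, h₂⟩, ⟨c, h₃⟩⟩ := h y z
  refine ⟨γ, hγ, h₁, ⟨b - e * w * d, ?_⟩, ⟨c, ?_⟩⟩
  · linear_combination h₂ - p ^ (n + 1) * e * w * hd
  · linear_combination h₃ - he + p ^ (n + 1) * e * hw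

theorem swapXY_mem {R : Type*} [CommRing R] : swapXY R ∈ fullAutGroup R :=
  Subgroup.subset_closure (by simp)

theorem cycA_mem {R : Type*} [CommRing R] : cycA R ∈ fullAutGroup R :=
  Subgroup.subset_closure (by simp)

theorem cycB_mem {R : Type*} [CommRing R] : cycB R ∈ fullAutGroup R :=
  Subgroup.subset_closure (by simp)

/-- Adjust the first coordinate, keeping the second one. -/
theorem exists_adjust_fst_fix_snd (hp : 3 < p) {x y z : ℤ_[p]} (hy : GoodTrace y)
    (hu : IsUnit (2 * z - x * y)) {n : ℕ} {x' : ℤ_[p]} (hx : (p : ℤ_[p]) ^ (n + 1) ∣ x' - x) :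
    ∃ γ ∈ fullAutGroup ℤ_[p], (γ (x, y, z)).2.1 = y ∧
      (p : ℤ_[p]) ^ (n + 2) ∣ (γ (x, y, z)).1 - x' ∧
      (p : ℤ_[p]) ^ (n + 1) ∣ (γ (x, y, z)).2.2 - z := by
  rw [mul_comm x] at hu
  obtain ⟨γ, hγ, h⟩ := exists_adjust_snd_fix_fst hp hy hu hx
  exact ⟨swapXY _ * γ * swapXY _, mul_mem (mul_mem swapXY_mem hγ) swapXY_mem, h⟩

/-- Adjust the first coordinate, keeping the third one. -/
theorem exists_adjust_fst_fix_trd (hp : 3 < p) {x y z : ℤ_[p]} (hz : GoodTrace z)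
    (hu : IsUnit (2 * y - x * z)) {n : ℕ} {x' : ℤ_[p]} (hx : (p : ℤ_[p]) ^ (n + 1) ∣ x' - x) :
    ∃ γ ∈ fullAutGroup ℤ_[p], (γ (x, y, z)).2.2 = z ∧
      (p : ℤ_[p]) ^ (n + 2) ∣ (γ (x, y, z)).1 - x' ∧
      (p : ℤ_[p]) ^ (n + 1) ∣ (γ (x, y, z)).2.1 - y := by
  rw [mul_comm x] at hu
  obtain ⟨γ, hγ, h⟩ := exists_adjust_snd_fix_fst hp hz hu hx
  exact ⟨cycA _ * γ * cycB _, mul_mem (mul_mem cycA_mem hγ) cycB_mem, h⟩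

/-- Adjust the third coordinate near a critical point of the first one, keeping the others. -/
theorem exists_adjust_trd_fix_snd (hp : 3 < p) {x y z : ℤ_[p]} (hy : GoodTrace y)
    (hd : (p : ℤ_[p]) ∣ 2 * z - x * y) (hu : IsUnit (2 * x - y * z)) {n : ℕ} {z' : ℤ_[p]}
    (hz : (p : ℤ_[p]) ^ (n + 1) ∣ z' - z) :
    ∃ γ ∈ fullAutGroup ℤ_[p], (γ (x, y, z)).2.1 = y ∧
      (p : ℤ_[p]) ^ (n + 2) ∣ (γ (x, y, z)).1 - x ∧
      (p : ℤ_[p]) ^ (n + 2) ∣ (γ (x, y, z)).2.2 - z' := by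
  rw [mul_comm x] at hd
  obtain ⟨γ, hγ, h⟩ := exists_adjust_trd_fix_fst hp hy hd hu hz
  exact ⟨swapXY _ * γ * swapXY _, mul_mem (mul_mem swapXY_mem hγ) swapXY_mem, h⟩

theorem markoffPoly_sub {R : Type*} [CommRing R] (u v : R × R × R) :
    markoffPoly u - markoffPoly v = (u.1 - v.1) * (u.1 + v.1 - v.2.1 * v.2.2) +
      (u.2.1 - v.2.1) * (u.2.1 + v.2.1 - u.1 * v.2.2) +
      (u.2.2 - v.2.2) * (u.2.2 + v.2.2 - u.1 * u.2.1) := by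
  simp only [markoffPoly]
  ring

theorem mapTriple_eq_of_tripleCong {u v : ℤ_[p] × ℤ_[p] × ℤ_[p]}
    (h : TripleCong (p : ℤ_[p]) u v) :
    mapTriple PadicInt.toZMod u = mapTriple PadicInt.toZMod v := by
  simpa [TripleCong, prime_dvd_sub_iff, mapTriple] using h

theorem tripleCong_prime_iff {u v : ℤ_[p] × ℤ_[p] × ℤ_[p]} :
    TripleCong (p : ℤ_[p]) u v ↔
      mapTriple PadicInt.toZMod u = mapTriple PadicInt.toZMod v := by
  simp [TripleCong, prime_dvd_sub_iff, mapTriple]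

/-- A residue point `v₀` around which the group action is transitive modulo all powers of `p`. -/
def LocallyTransitive (D : ℤ_[p]) (v₀ : ZMod p × ZMod p × ZMod p) : Prop :=
  ∀ a b : ℤ_[p] × ℤ_[p] × ℤ_[p], markoffPoly a = D → markoffPoly b = D →
    mapTriple PadicInt.toZMod a = v₀ → mapTriple PadicInt.toZMod b = v₀ →
      ∀ n : ℕ, ∃ γ ∈ fullAutGroup ℤ_[p], TripleCong ((p : ℤ_[p]) ^ (n + 1)) (γ a) b

theorem locallyTransitive_two_two (hp : 3 < p) (D : ℤ_[p]) {t : ZMod p} (ht : t ≠ 0) :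
    LocallyTransitive D (2, 2, 2 - t) := by
  intro a b ha hb ha₀ hb₀ n
  induction n with
  | zero =>
    refine ⟨1, one_mem _, ?_⟩
    simpa [tripleCong_prime_iff] using ha₀.trans hb₀.symm
  | succ n ih =>
    obtain ⟨γ₁, hγ₁, hc₁⟩ := ih
    have hP : markoffPoly (γ₁ a) = D := (markoffPoly_fullAutGroup hγ₁ a).trans ha
    generalize ha₁ : γ₁ a = a₁ at hc₁ hP
    obtain ⟨x', y', z'⟩ := b
    have red : ∀ v : ℤ_[p] × ℤ_[p] × ℤ_[p], TripleCong ((p : ℤ_[p]) ^ (n + 1)) v (x', y', z') →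
        PadicInt.toZMod v.1 = 2 ∧ PadicInt.toZMod v.2.1 = 2 ∧ PadicInt.toZMod v.2.2 = 2 - t := by
      intro v hv
      have h := mapTriple_eq_of_tripleCong (hv.of_dvd (dvd_pow_self _ n.succ_ne_zero))
      rw [hb₀] at h
      simpa [mapTriple] using h
    have good : ∀ w : ℤ_[p], PadicInt.toZMod w = 2 → GoodTrace w := by
      intro w hw
      apply goodTrace_of_dvd_sub_two hp
      rw [prime_dvd_sub_iff, hw, map_ofNat]
    have unit : ∀ x y z : ℤ_[p], PadicInt.toZMod x = 2 → PadicInt.toZMod y = 2 →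
        PadicInt.toZMod z = 2 - t → IsUnit (2 * z - x * y) := by
      intro x y z hx hy hz
      rw [isUnit_iff_toZMod_ne_zero, map_sub, map_mul, map_mul, hx, hy, hz, map_ofNat]
      have h : (2 * (2 - t) - 2 * 2 : ZMod p) = -(2 * t) := by ring
      rw [h]
      exact neg_ne_zero.mpr (mul_ne_zero (two_ne_zero_zmod hp) ht)
    obtain ⟨x, y, z⟩ := a₁
    obtain ⟨hx, hy, hz⟩ := red _ hc₁
    obtain ⟨γ₂, hγ₂, e₂, f₂, g₂⟩ := exists_adjust_fst_fix_snd hp (good y hy) (unit x y z hx hy hz)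
      hc₁.symm.1
    have hP₂ := (markoffPoly_fullAutGroup hγ₂ (x, y, z)).trans hP
    have hc₂ : TripleCong ((p : ℤ_[p]) ^ (n + 1)) (γ₂ (x, y, z)) (x', y', z') :=
      ⟨(pow_dvd_pow _ (Nat.le_succ _)).trans f₂, by rw [e₂]; exact hc₁.2.1,
        by simpa using dvd_add g₂ hc₁.2.2⟩
    generalize ha₂ : γ₂ (x, y, z) = a₂ at *
    obtain ⟨X, Y, Z⟩ := a₂
    obtain ⟨hX, hY, hZ⟩ := red _ hc₂
    obtain ⟨γ₃, hγ₃, e₃, f₃, g₃⟩ := exists_adjust_snd_fix_fst hp (good X hX) (unit X Y Z hX hY hZ)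
      hc₂.symm.2.1
    have hP₃ := (markoffPoly_fullAutGroup hγ₃ (X, Y, Z)).trans hP₂
    have hc₃ : TripleCong ((p : ℤ_[p]) ^ (n + 1)) (γ₃ (X, Y, Z)) (x', y', z') :=
      ⟨by rw [e₃]; exact hc₂.1, (pow_dvd_pow _ (Nat.le_succ _)).trans f₃,
        by simpa using dvd_add g₃ hc₂.2.2⟩
    refine ⟨γ₃ * γ₂ * γ₁, mul_mem (mul_mem hγ₃ hγ₂) hγ₁, ?_⟩
    rw [Equiv.Perm.mul_apply, Equiv.Perm.mul_apply, ha₁, ha₂]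
    generalize γ₃ (X, Y, Z) = a₃ at *
    obtain ⟨x₃, y₃, z₃⟩ := a₃
    obtain ⟨hx₃, hy₃, hz₃⟩ := red _ hc₃
    have hfx : (p : ℤ_[p]) ^ (n + 2) ∣ x₃ - x' := by
      dsimp only at e₃
      rw [e₃]
      exact f₂
    refine ⟨hfx, f₃, ?_⟩
    have hsub := markoffPoly_sub (x₃, y₃, z₃) (x', y', z')
    rw [hP₃, hb, sub_self] at hsub
    have hU : IsUnit (z₃ + z' - x₃ * y₃) := by
      have h := unit _ _ _ hx₃ hy₃ hz₃
      have hz' := (prime_dvd_sub_iff _ _).mp ((dvd_pow_self (p : ℤ_[p]) n.succ_ne_zero).trans hc₃.2.2)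
      rw [isUnit_iff_toZMod_ne_zero] at h ⊢
      simpa [← hz', two_mul] using h
    rw [← hU.dvd_mul_right, ← dvd_add_right (dvd_add (hfx.mul_right (x₃ + x' - y' * z'))
      (f₃.mul_right (y₃ + y' - x₃ * z'))), ← hsub]
    exact dvd_zero _

end Moves

section FermatQuotient

/-- The sum of the terms of the binomial expansion of `(1 + T) ^ p` other than the two extreme
ones, divided by `p`. -/
def binomialMiddle {R : Type*} [CommRing R] (p : ℕ) (T : R) : R :=
  ∑ k ∈ Finset.Ioo 0 p, ((p.choose k / p : ℕ) : R) * T ^ k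

theorem one_add_pow_prime {R : Type*} [CommRing R] {p : ℕ} (hp : p.Prime) (T : R) :
    (1 + T) ^ p = 1 + T ^ p + p * binomialMiddle p T := by
  rw [add_comm 1 T, add_pow, Finset.sum_range_succ, Finset.range_eq_Ico,
    ← Finset.Ioo_insert_left hp.pos,
    Finset.sum_insert Finset.left_notMem_Ioo, binomialMiddle, Finset.mul_sum]
  have h : ∀ k ∈ Finset.Ioo 0 p, T ^ k * 1 ^ (p - k) * (p.choose k : R) =
      p * (((p.choose k / p : ℕ) : R) * T ^ k) := by
    intro k hk
    rw [Finset.mem_Ioo] at hk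
    obtain ⟨c, hc⟩ := hp.dvd_choose_self hk.1.ne' hk.2
    rw [hc, Nat.mul_div_cancel_left _ hp.pos, one_pow]
    push_cast
    ring
  rw [Finset.sum_congr rfl h]
  simp
  ring

theorem map_binomialMiddle {R S : Type*} [CommRing R] [CommRing S] (f : R →+* S) (p : ℕ) (T : R) :
    f (binomialMiddle p T) = binomialMiddle p (f T) := by
  simp [binomialMiddle]

theorem binomialMiddle_zero {R : Type*} [CommRing R] (p : ℕ) :
    binomialMiddle p (0 : R) = 0 := by
  refine Finset.sum_eq_zero fun k hk => ?_
  rw [zero_pow (Finset.mem_Ioo.mp hk).1.ne', mul_zero]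

theorem binomialMiddle_neg_one {R : Type*} [CommRing R] {p : ℕ} (hp : p.Prime) (ho : Odd p) :
    binomialMiddle p (-1 : R) = 0 := by
  have h := one_add_pow_prime hp (-1 : ℤ)
  rw [ho.neg_one_pow, add_neg_cancel, zero_pow hp.ne_zero] at h
  have h0 : binomialMiddle p (-1 : ℤ) = 0 := by
    have h1 : (p : ℤ) * binomialMiddle p (-1 : ℤ) = 0 := by linarith
    exact (mul_eq_zero.mp h1).resolve_left (by exact_mod_cast hp.ne_zero)
  have := map_binomialMiddle (Int.castRingHom R) p (-1)
  rw [h0] at this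
  simpa using this.symm

variable {p : ℕ} [Fact p.Prime]

theorem exists_binomialMiddle_ne_zero (hp : 5 < p) :
    ∃ s : ZMod p, (s + 1) * binomialMiddle p (-s) + (s - 1) * binomialMiddle p s ≠ 0 := by
  by_contra! h
  have hpp : p.Prime := Fact.out
  set b : ℕ → ZMod p := fun k => ((p.choose k / p : ℕ) : ZMod p) with hb
  set G : (ZMod p)[X] := ∑ k ∈ Finset.Ioo 0 p, C (b k) * X ^ k with hG
  set G' : (ZMod p)[X] := ∑ k ∈ Finset.Ioo 0 p, C ((-1) ^ k * b k) * X ^ k with hG'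
  have hGc : ∀ k, G.coeff k = if k ∈ Finset.Ioo 0 p then b k else 0 := by
    intro k
    simp only [hG, finsetSum_coeff, coeff_C_mul_X_pow]
    rw [Finset.sum_ite_eq]
  have hGc' : ∀ k, G'.coeff k = if k ∈ Finset.Ioo 0 p then (-1) ^ k * b k else 0 := by
    intro k
    simp only [hG', finsetSum_coeff, coeff_C_mul_X_pow]
    rw [Finset.sum_ite_eq]
  set H : (ZMod p)[X] := X * (G' + G) + (G' - G) with hH
  have heval : ∀ s, H.eval s = 0 := by
    intro s
    rw [← h s]
    simp only [hH, hG, hG', binomialMiddle, eval_add, eval_sub, eval_mul, eval_X, eval_finsetSum,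
      eval_C, eval_pow, hb]
    have e : ∑ k ∈ Finset.Ioo 0 p, (-1) ^ k * ((p.choose k / p : ℕ) : ZMod p) * s ^ k =
        ∑ k ∈ Finset.Ioo 0 p, ((p.choose k / p : ℕ) : ZMod p) * (-s) ^ k := by
      refine Finset.sum_congr rfl fun k _ => ?_
      rw [neg_pow s]
      ring
    rw [e]
    ring
  have hHc : ∀ k, H.coeff (k + 1) = (G'.coeff k + G.coeff k) + (G'.coeff (k + 1) - G.coeff (k + 1))
      := by
    intro k
    simp [hH, coeff_X_mul]
  set F : (ZMod p)[X] := H - C (H.coeff p) * (X ^ p - X) with hF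
  have hF0 : F = 0 := by
    apply eq_zero_of_natDegree_lt_card_of_eval_eq_zero F Function.injective_id
    · intro s
      simp [hF, heval, ZMod.pow_card]
    · rw [ZMod.card]
      have hlt : F.degree < p := by
        rw [degree_lt_iff_coeff_zero]
        intro m hm
        rcases hm.eq_or_lt with rfl | hm
        · simp [hF, coeff_X, show ¬1 = p by omega]
        · obtain ⟨k, rfl⟩ : ∃ k, m = k + 1 := ⟨m - 1, by omega⟩
          simp [hF, hHc, hGc, hGc', coeff_X, coeff_X_pow, show ¬(k < p) by omega,
            show ¬(k + 1 < p) by omega, show ¬(k + 1 = p) by omega, show ¬(k = 0) by omega]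
      by_cases hz : F = 0
      · simp [hz, hpp.pos]
      · exact (natDegree_lt_iff_degree_lt hz).mpr hlt
  have h3 : F.coeff 3 = 2 * (b 2 - b 3) := by
    simp only [hF, coeff_sub, coeff_C_mul, hHc 2, hGc, hGc', coeff_X, coeff_X_pow, Finset.mem_Ioo]
    simp [show 2 < p by omega, show 3 < p by omega, show ¬(3 = p) by omega]
    ring
  rw [hF0, coeff_zero] at h3
  obtain ⟨m, rfl⟩ : ∃ m, p = m + 2 := ⟨p - 2, by omega⟩
  have hm : (m : ZMod (m + 2)) = -2 := by
    have := ZMod.natCast_self (m + 2)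
    push_cast at this
    linear_combination this
  have hbk : ∀ k, k + 1 < m + 2 → b (k + 1) * (k + 1) = ((m + 1).choose k : ZMod (m + 2)) := by
    intro k hk
    obtain ⟨c, hc⟩ := hpp.dvd_choose_self k.succ_ne_zero hk
    have h1 := Nat.add_one_mul_choose_eq (m + 1) k
    have h2 : (m + 1).choose k = c * (k + 1) := by
      rw [hc] at h1
      nlinarith [Nat.eq_of_mul_eq_mul_left hpp.pos (h1.trans (mul_assoc _ _ _))]
    simp only [hb]
    rw [hc, Nat.mul_div_cancel_left _ hpp.pos, h2]
    push_cast
    ring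
  have hb2 := hbk 1 (by omega)
  have hb3 := hbk 2 (by omega)
  have hc2 : (((m + 1).choose 2 : ℕ) : ZMod (m + 2)) * 2 = (m + 1) * m := by
    have := Nat.add_one_mul_choose_eq m 1
    rw [Nat.choose_one_right, one_add_one_eq_two] at this
    exact_mod_cast congrArg (Nat.cast (R := ZMod (m + 2))) this.symm
  rw [Nat.choose_one_right] at hb2
  push_cast at hb2 hb3
  rw [hm] at hb2 hc2
  norm_num at hb2 hb3
  have h5 : ((5 : ℕ) : ZMod (m + 2)) = 0 := by
    push_cast
    linear_combination 3 * h3 + 3 * hb2 - 2 * hb3 - hc2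
  exact natCast_zmod_ne_zero_of_lt (by omega) hp h5

theorem exists_fermat_quotient (hp : 5 < p) :
    ∃ T : ℤ_[p], (p : ℤ_[p]) ^ 2 ∣ T ^ p - T ∧ IsUnit T ∧ IsUnit (T ^ 2 - 1) ∧
      ¬(p : ℤ_[p]) ^ 2 ∣ (T - 1) ^ p * (T + 1) - (T + 1) ^ p * (T - 1) := by
  have hpp : p.Prime := Fact.out
  have ho : Odd p := hpp.odd_of_ne_two (by omega)
  obtain ⟨s, hs⟩ := exists_binomialMiddle_ne_zero hp
  have hs0 : s ≠ 0 := by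
    rintro rfl
    simp [binomialMiddle_zero] at hs
  have hs1 : s ^ 2 - 1 ≠ 0 := by
    intro h
    have h' : (s - 1) * (s + 1) = 0 := by linear_combination h
    rcases mul_eq_zero.mp h' with h' | h'
    · rw [sub_eq_zero] at h'
      subst h'
      simp [binomialMiddle_neg_one hpp ho] at hs
    · rw [add_eq_zero_iff_eq_neg] at h'
      subst h'
      simp [binomialMiddle_neg_one hpp ho] at hs
  set T₀ : ℤ_[p] := (s.val : ℤ_[p]) with hT₀
  have hTs : PadicInt.toZMod (T₀ ^ p) = s := by
    rw [map_pow, hT₀, map_natCast, ZMod.natCast_zmod_val, ZMod.pow_card]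
  have hT : (p : ℤ_[p]) ^ 2 ∣ (T₀ ^ p) ^ p - T₀ ^ p := by
    have h : (p : ℤ_[p]) ∣ T₀ ^ p - T₀ := by
      rw [prime_dvd_sub_iff, hTs, hT₀, map_natCast, ZMod.natCast_zmod_val]
    simpa using dvd_sub_pow_of_dvd_sub h 1
  generalize T₀ ^ p = T at hTs hT
  refine ⟨T, hT, ?_, ?_, ?_⟩
  · rwa [isUnit_iff_toZMod_ne_zero, hTs]
  · rwa [isUnit_iff_toZMod_ne_zero, map_sub, map_pow, hTs, map_one]
  · intro hd
    apply hs
    rw [← hTs, ← map_neg, ← map_binomialMiddle, ← map_binomialMiddle,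
      ← map_one PadicInt.toZMod, ← map_add, ← map_sub, ← map_mul, ← map_mul, ← map_add,
      ← prime_dvd_iff_toZMod_eq_zero]
    have h₁ := one_add_pow_prime hpp T
    have h₂ := one_add_pow_prime hpp (-T)
    have h₃ : (1 + -T) ^ p = -(T - 1) ^ p := by
      rw [← ho.neg_pow]
      ring
    rw [h₃, ho.neg_pow] at h₂
    obtain ⟨w, hw⟩ := hT
    obtain ⟨d, hd⟩ := hd
    refine ⟨2 * w - d, ?_⟩
    have hp0 : (p : ℤ_[p]) ≠ 0 := by exact_mod_cast hpp.ne_zero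
    apply mul_left_cancel₀ hp0
    rw [add_comm 1 T] at h₁
    linear_combination -hd + 2 * hw - (T - 1) * h₁ - (T + 1) * h₂

end FermatQuotient

section CriticalPoint

variable {p : ℕ} [Fact p.Prime]

theorem isUnit_sub_of_mapTriple {a : ℤ_[p] × ℤ_[p] × ℤ_[p]} {X Y Z : ZMod p}
    (ha : mapTriple PadicInt.toZMod a = (X, Y, Z)) :
    (2 * X - Y * Z ≠ 0 → IsUnit (2 * a.1 - a.2.1 * a.2.2)) ∧
    (2 * Y - X * Z ≠ 0 → IsUnit (2 * a.2.1 - a.1 * a.2.2)) ∧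
    (2 * Z - X * Y = 0 → (p : ℤ_[p]) ∣ 2 * a.2.2 - a.1 * a.2.1) := by
  simp only [mapTriple, Prod.mk.injEq] at ha
  obtain ⟨rfl, rfl, rfl⟩ := ha
  simp only [isUnit_iff_toZMod_ne_zero, prime_dvd_iff_toZMod_eq_zero, map_sub, map_mul, map_ofNat]
  exact ⟨id, id, id⟩

theorem exists_adjust_trd (hp : 3 < p) {a : ℤ_[p] × ℤ_[p] × ℤ_[p]} {X Y Z : ZMod p}
    (ha : mapTriple PadicInt.toZMod a = (X, Y, Z)) (hZ : 2 * Z - X * Y = 0)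
    (hX : 2 * X - Y * Z ≠ 0) (hY : 2 * Y - X * Z ≠ 0) (hg : GoodTrace a.1 ∨ GoodTrace a.2.1)
    {n : ℕ} {z' : ℤ_[p]} (hz : (p : ℤ_[p]) ^ (n + 1) ∣ z' - a.2.2) :
    ∃ γ ∈ fullAutGroup ℤ_[p], TripleCong ((p : ℤ_[p]) ^ (n + 2)) (γ a) (a.1, a.2.1, z') := by
  obtain ⟨h₁, h₂, h₃⟩ := isUnit_sub_of_mapTriple ha
  obtain ⟨x, y, z⟩ := a
  rcases hg with hg | hg
  · obtain ⟨γ, hγ, e₁, e₂, e₃⟩ := exists_adjust_trd_fix_fst hp hg (h₃ hZ) (h₂ hY) hz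
    exact ⟨γ, hγ, by simp [e₁], e₂, e₃⟩
  · obtain ⟨γ, hγ, e₁, e₂, e₃⟩ := exists_adjust_trd_fix_snd hp hg (h₃ hZ) (h₁ hX) hz
    exact ⟨γ, hγ, e₂, by simp [e₁], e₃⟩

theorem locallyTransitive_of_critical (hp : 3 < p) (D : ℤ_[p]) {X Y Z : ZMod p}
    (hZ : 2 * Z - X * Y = 0) (hX : 2 * X - Y * Z ≠ 0) (hY : 2 * Y - X * Z ≠ 0)
    (hZ4 : Z ^ 2 - 4 ≠ 0)
    (hgood : ∀ a : ℤ_[p] × ℤ_[p] × ℤ_[p], markoffPoly a = D →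
      mapTriple PadicInt.toZMod a = (X, Y, Z) → GoodTrace a.1 ∨ GoodTrace a.2.1) :
    LocallyTransitive D (X, Y, Z) := by
  have hz4 : ∀ a : ℤ_[p] × ℤ_[p] × ℤ_[p], mapTriple PadicInt.toZMod a = (X, Y, Z) →
      IsUnit (a.2.2 ^ 2 - 4) := by
    intro a ha
    simp only [mapTriple, Prod.mk.injEq] at ha
    rwa [isUnit_iff_toZMod_ne_zero, map_sub, map_pow, map_ofNat, ha.2.2]
  have core : ∀ a b : ℤ_[p] × ℤ_[p] × ℤ_[p], markoffPoly a = D → markoffPoly b = D →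
      mapTriple PadicInt.toZMod a = (X, Y, Z) → mapTriple PadicInt.toZMod b = (X, Y, Z) →
      ¬BadTrace b.2.2 → ∀ n : ℕ, ∃ γ ∈ fullAutGroup ℤ_[p],
        TripleCong ((p : ℤ_[p]) ^ (n + 1)) (γ a) b ∧ (p : ℤ_[p]) ^ 2 ∣ (γ a).2.2 - b.2.2 := by
    intro a b ha hb ha₀ hb₀ hbad n
    induction n with
    | zero =>
      have hab := tripleCong_prime_iff.mpr (ha₀.trans hb₀.symm)
      have hz := hab.symm.2.2
      rw [← pow_one (p : ℤ_[p])] at hz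
      obtain ⟨γ, hγ, hc⟩ := exists_adjust_trd hp ha₀ hZ hX hY (hgood a ha ha₀) (n := 0) hz
      refine ⟨γ, hγ, ?_, hc.2.2⟩
      rw [zero_add, pow_one]
      refine (hc.of_dvd (dvd_pow_self _ two_ne_zero)).trans ⟨hab.1, hab.2.1, ?_⟩
      simp
    | succ n ih =>
      obtain ⟨γ₁, hγ₁, hc₁, hz₁⟩ := ih
      have hP := (markoffPoly_fullAutGroup hγ₁ a).trans ha
      have red : ∀ v : ℤ_[p] × ℤ_[p] × ℤ_[p], TripleCong ((p : ℤ_[p]) ^ (n + 1)) v b →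
          mapTriple PadicInt.toZMod v = (X, Y, Z) := fun v hv =>
        (mapTriple_eq_of_tripleCong (hv.of_dvd (dvd_pow_self _ n.succ_ne_zero))).trans hb₀
      generalize ha₁ : γ₁ a = a₁ at hc₁ hP hz₁
      have hgz : GoodTrace a₁.2.2 := by
        apply goodTrace_of_not_badTrace hp (hz4 _ (red _ hc₁))
        exact fun h => hbad (h.of_dvd_sub hz₁)
      obtain ⟨γ₂, hγ₂, e₂, f₂, g₂⟩ := exists_adjust_fst_fix_trd hp hgz
        ((isUnit_sub_of_mapTriple (red _ hc₁)).2.1 hY) hc₁.symm.1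
      have hP₂ := (markoffPoly_fullAutGroup hγ₂ a₁).trans hP
      have hc₂ : TripleCong ((p : ℤ_[p]) ^ (n + 1)) (γ₂ a₁) b :=
        ⟨(pow_dvd_pow _ (Nat.le_succ _)).trans f₂, by simpa using dvd_add g₂ hc₁.2.1,
          by rw [show (γ₂ a₁).2.2 = a₁.2.2 from e₂]; exact hc₁.2.2⟩
      replace f₂ : (p : ℤ_[p]) ^ (n + 2) ∣ (γ₂ a₁).1 - b.1 := f₂
      generalize ha₂ : γ₂ a₁ = a₂ at hP₂ hc₂ f₂
      have red₂ := red _ hc₂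
      have hy₂ : (p : ℤ_[p]) ^ (n + 2) ∣ a₂.2.1 - b.2.1 := by
        have hsub := markoffPoly_sub a₂ b
        rw [hP₂, hb, sub_self] at hsub
        simp only [mapTriple, Prod.mk.injEq] at red₂ hb₀
        have hU : IsUnit (a₂.2.1 + b.2.1 - a₂.1 * b.2.2) := by
          rw [isUnit_iff_toZMod_ne_zero]
          simpa [red₂, hb₀, two_mul] using hY
        have hd : (p : ℤ_[p]) ∣ a₂.2.2 + b.2.2 - a₂.1 * a₂.2.1 := by
          rw [prime_dvd_iff_toZMod_eq_zero]
          simpa [red₂, hb₀, two_mul] using hZ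
        have hzz : (p : ℤ_[p]) ^ (n + 2) ∣
            (a₂.2.2 - b.2.2) * (a₂.2.2 + b.2.2 - a₂.1 * a₂.2.1) := by
          rw [pow_succ]
          exact mul_dvd_mul hc₂.2.2 hd
        rw [← hU.dvd_mul_right]
        rw [← dvd_add_right (f₂.mul_right (a₂.1 + b.1 - b.2.1 * b.2.2)),
          ← dvd_add_left hzz, ← hsub]
        exact dvd_zero _
      obtain ⟨γ₃, hγ₃, hc₃⟩ := exists_adjust_trd hp red₂ hZ hX hY (hgood _ hP₂ red₂) hc₂.symm.2.2
      refine ⟨γ₃ * γ₂ * γ₁, mul_mem (mul_mem hγ₃ hγ₂) hγ₁, ?_⟩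
      rw [Equiv.Perm.mul_apply, Equiv.Perm.mul_apply, ha₁, ha₂]
      exact ⟨hc₃.trans ⟨f₂, hy₂, by simp⟩, (pow_dvd_pow _ (by omega)).trans hc₃.2.2⟩
  intro a b ha hb ha₀ hb₀ n
  by_cases hbad : BadTrace b.2.2
  · obtain ⟨δ, hδ, hc⟩ := exists_adjust_trd hp hb₀ hZ hX hY (hgood b hb hb₀) (n := 0)
      (z' := b.2.2 + p) (by simp)
    have hc' : TripleCong (p : ℤ_[p]) (δ b) b :=
      (hc.of_dvd (dvd_pow_self _ two_ne_zero)).trans ⟨by simp, by simp, by simp⟩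
    have hb₁ := (mapTriple_eq_of_tripleCong hc').trans hb₀
    have hnb : ¬BadTrace (δ b).2.2 := by
      intro h
      have h1 := hbad.sq_dvd_sub hp h (hz4 b hb₀) hc'.2.2
      have h2 : (p : ℤ_[p]) ^ 2 ∣ p := by simpa using dvd_sub h1 hc.2.2
      obtain ⟨c, h3⟩ := h2
      have hp0 : (p : ℤ_[p]) ≠ 0 := by exact_mod_cast (Fact.out : p.Prime).ne_zero
      have h4 : (p : ℤ_[p]) * c = 1 := mul_left_cancel₀ hp0 (by linear_combination -h3)
      exact PadicInt.prime_p.not_isUnit (IsUnit.of_mul_eq_one c h4)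
    obtain ⟨γ, hγ, hγc, -⟩ :=
      core a (δ b) ha ((markoffPoly_fullAutGroup hδ b).trans hb) ha₀ hb₁ hnb n
    refine ⟨δ⁻¹ * γ, mul_mem (inv_mem hδ) hγ, ?_⟩
    simpa using hγc.apply (inv_mem hδ)
  · obtain ⟨γ, hγ, hγc, -⟩ := core a b ha hb ha₀ hb₀ hbad n
    exact ⟨γ, hγ, hγc⟩

end CriticalPoint

section NonsquareCase

variable {p : ℕ} [Fact p.Prime]

theorem badTrace_add_of_mul_eq_one {T T' : ℤ_[p]} (hTT' : T * T' = 1) (hu : IsUnit (T - T'))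
    (hT : (p : ℤ_[p]) ^ 2 ∣ T ^ p - T) : BadTrace (T + T') := by
  have hTu : IsUnit T := IsUnit.of_mul_eq_one T' hTT'
  have h2 : (p : ℤ_[p]) ^ 2 ∣ T ^ (p ^ 2) - T := by
    have h := hT.trans (sub_dvd_pow_sub_pow (T ^ p) T p)
    rw [← pow_mul, ← sq] at h
    simpa using dvd_add h hT
  have h3 : (p : ℤ_[p]) ^ 2 ∣ T ^ (p ^ 2 - 1) - 1 := by
    have hp1 : p ^ 2 - 1 + 1 = p ^ 2 := Nat.sub_add_cancel (Nat.one_le_pow _ _ (NeZero.pos p))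
    rw [← hTu.dvd_mul_right, sub_mul, ← pow_succ, hp1, one_mul]
    exact h2
  rw [BadTrace, ← hu.dvd_mul_right, lucasU_of_mul_eq_one hTT']
  have h4 : T ^ (p ^ 2 - 1) * T' ^ (p ^ 2 - 1) = 1 := by rw [← mul_pow, hTT', one_pow]
  have h5 : T ^ (p ^ 2 - 1) - T' ^ (p ^ 2 - 1) =
      (T ^ (p ^ 2 - 1) - 1) * (1 + T' ^ (p ^ 2 - 1)) := by linear_combination -h4
  rw [h5]
  exact h3.mul_right _

theorem toZMod_pow_prime (a : ℤ_[p]) : PadicInt.toZMod (a ^ p) = PadicInt.toZMod a := by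
  rw [map_pow, ZMod.pow_card]

theorem toZMod_sub_mul_sub {T T' A B : ℤ_[p]} (hT : T * T' = 1)
    (hA : (T - 1) * A = 1) (hB : (T + 1) * B = 1) :
    PadicInt.toZMod ((T - T') * (((T + 1) * A) ^ p - ((T - 1) * B) ^ p)) = 4 := by
  have h1 : (T + 1) * A - (T - 1) * B = 4 * T * A * B := by
    linear_combination (T - 1) * B * hA - (T + 1) * A * hB
  have h2 : (T - T') * ((T + 1) * A - (T - 1) * B) = 4 := by
    linear_combination (T - T') * h1 - 4 * A * B * hT + 4 * (T + 1) * B * hA + 4 * hB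
  rw [map_mul, map_sub PadicInt.toZMod (_ ^ p), toZMod_pow_prime, toZMod_pow_prime, ← map_sub,
    ← map_mul, h2, map_ofNat]

/-- Two bad traces `T + T⁻¹` and `W + W⁻¹`, where `W ≡ (T + 1) / (T - 1)`, force a relation between
Fermat quotients when `(x² - 4) (y² - 4) ≡ 16` modulo `p ^ 2`. -/
theorem not_sq_dvd_of_fermat_quotient (hp : 3 < p) {T T' A B : ℤ_[p]} (hT : T * T' = 1)
    (hA : (T - 1) * A = 1) (hB : (T + 1) * B = 1) (h1 : IsUnit (T ^ 2 + 1))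
    (hq : ¬(p : ℤ_[p]) ^ 2 ∣ (T - 1) ^ p * (T + 1) - (T + 1) ^ p * (T - 1)) :
    ¬(p : ℤ_[p]) ^ 2 ∣ ((T - T') * (((T + 1) * A) ^ p - ((T - 1) * B) ^ p)) ^ 2 - 16 := by
  intro h
  apply hq
  set W := ((T + 1) * A) ^ p with hW
  set W' := ((T - 1) * B) ^ p with hW'
  have hWW : W * W' = 1 := by
    rw [hW, hW', ← mul_pow, show (T + 1) * A * ((T - 1) * B) = ((T - 1) * A) * ((T + 1) * B) by ring,
      hA, hB, one_mul, one_pow]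
  have hWz : PadicInt.toZMod W = PadicInt.toZMod ((T + 1) * A) := toZMod_pow_prime _
  have hs : PadicInt.toZMod ((T - T') * (W - W')) = 4 := toZMod_sub_mul_sub hT hA hB
  have h8 : IsUnit ((T - T') * (W - W') + 4) := by
    rw [isUnit_iff_toZMod_ne_zero, map_add, hs, map_ofNat]
    have : (4 + 4 : ZMod p) = 2 * 2 * 2 := by norm_num
    rw [this]
    have h2 := two_ne_zero_zmod hp
    exact mul_ne_zero (mul_ne_zero h2 h2) h2
  have h3 : (p : ℤ_[p]) ^ 2 ∣ (T - T') * (W - W') - 4 := by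
    rw [← h8.dvd_mul_right]
    convert h using 1
    ring
  have h4 : (p : ℤ_[p]) ^ 2 ∣ ((T - 1) * W - (T + 1)) * ((T + 1) * W + (T - 1)) := by
    convert h3.mul_right (T * W) using 1
    linear_combination (W ^ 2 - W * W') * hT + (T ^ 2 - 1) * hWW
  have h5 : IsUnit ((T + 1) * W + (T - 1)) := by
    have h6 : IsUnit (A * (2 * (T ^ 2 + 1))) :=
      (IsUnit.of_mul_eq_one_right _ hA).mul ((isUnit_two hp).mul h1)
    rw [isUnit_iff_toZMod_ne_zero] at h6 ⊢
    rw [map_add, map_mul, hWz, ← map_mul, ← map_add]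
    convert h6 using 2
    linear_combination -(T - 1) * hA
  rw [h5.dvd_mul_right] at h4
  have hWp : (T - 1) ^ p * W = (T + 1) ^ p := by
    rw [hW, ← mul_pow, show (T - 1) * ((T + 1) * A) = (T + 1) * ((T - 1) * A) by ring, hA, mul_one]
  convert (h4.mul_left ((T - 1) ^ p)).neg_right using 1
  linear_combination (T - 1) * hWp

theorem four_mul_markoffPoly {R : Type*} [CommRing R] (v : R × R × R) :
    4 * markoffPoly v = (2 * v.2.2 - v.1 * v.2.1) ^ 2 - (v.1 ^ 2 - 4) * (v.2.1 ^ 2 - 4) + 16 := by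
  simp only [markoffPoly]
  ring

theorem exists_locallyTransitive_of_nonsquare (hp : 5 < p) {D : ℤ_[p]}
    (hD : (p : ℤ_[p]) ^ 2 ∣ D) (hsq : ∀ s : ZMod p, s ^ 2 ≠ -1) :
    ∃ v₀ ∈ markoffSet (ZMod p) (PadicInt.toZMod D), LocallyTransitive D v₀ := by
  have hp3 : 3 < p := by omega
  obtain ⟨T, hTp, hTu, hT1, hq⟩ := exists_fermat_quotient hp
  obtain ⟨T', hT'⟩ := hTu.exists_right_inv
  have hfac : T ^ 2 - 1 = (T - 1) * (T + 1) := by ring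
  rw [hfac] at hT1
  obtain ⟨A, hA⟩ := (isUnit_of_mul_isUnit_left hT1).exists_right_inv
  obtain ⟨B, hB⟩ := (isUnit_of_mul_isUnit_right hT1).exists_right_inv
  have hT2 : IsUnit (T ^ 2 + 1) := by
    rw [isUnit_iff_toZMod_ne_zero, map_add, map_pow, map_one]
    exact fun h => hsq _ (eq_neg_of_add_eq_zero_left h)
  have hkey := not_sq_dvd_of_fermat_quotient hp3 hT' hA hB hT2 hq
  have hWz := toZMod_pow_prime ((T + 1) * A)
  have hWz' := toZMod_pow_prime ((T - 1) * B)
  have hs := toZMod_sub_mul_sub hT' hA hB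
  have hWp : (p : ℤ_[p]) ^ 2 ∣ (((T + 1) * A) ^ p) ^ p - ((T + 1) * A) ^ p := by
    have h : (p : ℤ_[p]) ∣ ((T + 1) * A) ^ p - (T + 1) * A := by rw [prime_dvd_sub_iff, hWz]
    simpa using dvd_sub_pow_of_dvd_sub h 1
  have hWW : ((T + 1) * A) ^ p * ((T - 1) * B) ^ p = 1 := by
    rw [← mul_pow, show (T + 1) * A * ((T - 1) * B) = ((T - 1) * A) * ((T + 1) * B) by ring,
      hA, hB, one_mul, one_pow]
  generalize ((T + 1) * A) ^ p = W at *
  generalize ((T - 1) * B) ^ p = W' at *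
  have u2 := isUnit_two hp3
  have uT' : IsUnit T' := IsUnit.of_mul_eq_one_right _ hT'
  have uA : IsUnit A := IsUnit.of_mul_eq_one_right _ hA
  have uB : IsUnit B := IsUnit.of_mul_eq_one_right _ hB
  have u1 : IsUnit (T - T') := by
    convert uT'.mul hT1 using 1
    linear_combination -T * hT'
  have u3 : IsUnit (W - W') := by
    have h : IsUnit (2 * 2 * T * A * B) := (((u2.mul u2).mul hTu).mul uA).mul uB
    rw [isUnit_iff_toZMod_ne_zero] at h ⊢
    rw [map_sub, hWz, hWz', ← map_sub]
    convert h using 2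
    linear_combination (T - 1) * B * hA - (T + 1) * A * hB
  have u4 : IsUnit (T + T') := by
    convert uT'.mul hT2 using 1
    linear_combination -T * hT'
  have u5 : IsUnit (W + W') := by
    have h : IsUnit (2 * (T ^ 2 + 1) * A * B) := ((u2.mul hT2).mul uA).mul uB
    rw [isUnit_iff_toZMod_ne_zero] at h ⊢
    rw [map_add, hWz, hWz', ← map_add]
    convert h using 2
    linear_combination -(T - 1) * B * hA - (T + 1) * A * hB
  obtain ⟨c, hc⟩ := u2.exists_right_inv
  have uc : IsUnit c := IsUnit.of_mul_eq_one_right _ hc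
  have hx : (T + T') ^ 2 - 4 = (T - T') ^ 2 := by linear_combination 4 * hT'
  have hy : (W + W') ^ 2 - 4 = (W - W') ^ 2 := by linear_combination 4 * hWW
  have badx : BadTrace (T + T') := badTrace_add_of_mul_eq_one hT' u1 hTp
  have bady : BadTrace (W + W') := badTrace_add_of_mul_eq_one hWW u3 hWp
  have hxy : ((T + T') ^ 2 - 4) * ((W + W') ^ 2 - 4) = ((T - T') * (W - W')) ^ 2 := by
    rw [hx, hy, mul_pow]
  have ux : IsUnit ((T + T') ^ 2 - 4) := hx ▸ u1.pow 2
  have uy : IsUnit ((W + W') ^ 2 - 4) := hy ▸ u3.pow 2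
  generalize T + T' = x₀ at *
  generalize W + W' = y₀ at *
  have hxy₄ := congrArg PadicInt.toZMod hxy
  rw [map_pow, hs, map_mul, map_sub, map_sub, map_pow, map_pow, map_ofNat] at hxy₄
  have hz : 2 * (x₀ * y₀ * c) = x₀ * y₀ := by linear_combination x₀ * y₀ * hc
  have ux' : IsUnit (2 * x₀ - y₀ * (x₀ * y₀ * c)) := by
    convert ((u4.mul uc).mul uy).neg using 1
    linear_combination -2 * x₀ * hc
  have uy' : IsUnit (2 * y₀ - x₀ * (x₀ * y₀ * c)) := by
    convert ((u5.mul uc).mul ux).neg using 1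
    linear_combination -2 * y₀ * hc
  generalize x₀ * y₀ * c = z₀ at *
  have h2 := two_ne_zero_zmod hp3
  have h4 : (4 : ZMod p) ≠ 0 := by
    rw [show (4 : ZMod p) = 2 * 2 by norm_num]
    exact mul_ne_zero h2 h2
  have hzm := congrArg PadicInt.toZMod hz
  rw [map_mul, map_mul, map_ofNat] at hzm
  have hXm : 2 * PadicInt.toZMod x₀ - PadicInt.toZMod y₀ * PadicInt.toZMod z₀ ≠ 0 := by
    rwa [isUnit_iff_toZMod_ne_zero, map_sub, map_mul, map_mul, map_ofNat] at ux'
  have hYm : 2 * PadicInt.toZMod y₀ - PadicInt.toZMod x₀ * PadicInt.toZMod z₀ ≠ 0 := by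
    rwa [isUnit_iff_toZMod_ne_zero, map_sub, map_mul, map_mul, map_ofNat] at uy'
  refine ⟨(PadicInt.toZMod x₀, PadicInt.toZMod y₀, PadicInt.toZMod z₀), ⟨?_, Or.inl ?_⟩, ?_⟩
  · rw [(prime_dvd_iff_toZMod_eq_zero D).mp ((dvd_pow_self _ two_ne_zero).trans hD)]
    apply mul_left_cancel₀ h4
    have h := four_mul_markoffPoly
      (PadicInt.toZMod x₀, PadicInt.toZMod y₀, PadicInt.toZMod z₀)
    simp only [markoffPoly] at h
    rw [h, hxy₄, hzm]
    ring
  · exact isUnit_iff_ne_zero.mpr hXm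
  · apply locallyTransitive_of_critical hp3 D (sub_eq_zero.mpr hzm) hXm hYm
    · intro hZ
      have hcm := congrArg PadicInt.toZMod hc
      rw [map_mul, map_ofNat, map_one] at hcm
      generalize PadicInt.toZMod x₀ = X at *
      generalize PadicInt.toZMod y₀ = Y at *
      generalize PadicInt.toZMod z₀ = Z at *
      generalize PadicInt.toZMod c = C at *
      have hsum : X ^ 2 + Y ^ 2 = 4 := by
        apply mul_left_cancel₀ h4
        linear_combination -hxy₄ - (X * Y + 2 * Z) * hzm + 4 * hZ
      have hC4 : 16 * C ^ 4 = 1 := by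
        linear_combination (2 * C + 1) * (4 * C ^ 2 + 1) * hcm
      apply hsq ((2 * X - Z * Y) * C ^ 2)
      linear_combination 4 * C ^ 4 * hsum + 4 * C ^ 4 * Z * hzm + C ^ 4 * (Y ^ 2 - 8) * hZ - hC4
    · intro a ha ha₀
      by_contra! hbad
      simp only [mapTriple, Prod.mk.injEq, ← prime_dvd_sub_iff] at ha₀
      have key : ∀ x x₁ : ℤ_[p], BadTrace x₁ → IsUnit (x₁ ^ 2 - 4) → (p : ℤ_[p]) ∣ x - x₁ →
          ¬GoodTrace x → (p : ℤ_[p]) ^ 2 ∣ x - x₁ := by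
        intro x x₁ hb hu hd hg
        refine hb.sq_dvd_sub hp3 ?_ hu hd
        by_contra hb'
        refine hg (goodTrace_of_not_badTrace hp3 ?_ hb')
        rw [isUnit_iff_toZMod_ne_zero, map_sub, map_pow] at hu ⊢
        rwa [(prime_dvd_sub_iff _ _).mp hd]
      obtain ⟨c₁, h₁⟩ := key _ _ badx ux ha₀.1 hbad.1
      obtain ⟨c₂, h₂⟩ := key _ _ bady uy ha₀.2.1 hbad.2
      obtain ⟨d₁, e₁⟩ := ha₀.1
      obtain ⟨d₂, e₂⟩ := ha₀.2.1
      obtain ⟨d₃, e₃⟩ := ha₀.2.2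
      obtain ⟨c₃, h₃⟩ := hD
      have hP := four_mul_markoffPoly a
      rw [ha] at hP
      obtain ⟨d, hd⟩ : (p : ℤ_[p]) ∣ 2 * a.2.2 - a.1 * a.2.1 :=
        ⟨2 * d₃ - d₁ * a.2.1 - x₀ * d₂, by
          linear_combination 2 * e₃ - a.2.1 * e₁ - x₀ * e₂ + hz⟩
      apply hkey
      rw [← hxy]
      refine ⟨d ^ 2 - 4 * c₃ - c₁ * (a.1 + x₀) * (a.2.1 ^ 2 - 4) -
        (x₀ ^ 2 - 4) * c₂ * (a.2.1 + y₀), ?_⟩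
      linear_combination hP - 4 * h₃ + (2 * a.2.2 - a.1 * a.2.1 + p * d) * hd -
        (a.1 + x₀) * (a.2.1 ^ 2 - 4) * h₁ - (x₀ ^ 2 - 4) * (a.2.1 + y₀) * h₂

end NonsquareCase

section Minimality

variable {p : ℕ} [Fact p.Prime]

theorem mem_markoffSet_two_two (hp : 3 < p) {D t : ZMod p} (ht : t ≠ 0) (hD : t ^ 2 = D - 4) :
    ((2, 2, 2 - t) : ZMod p × ZMod p × ZMod p) ∈ markoffSet (ZMod p) D := by
  refine ⟨by linear_combination hD, Or.inr (Or.inr ?_)⟩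
  rw [isUnit_iff_ne_zero, show 2 * (2 - t) - 2 * 2 = -(2 * t) by ring]
  exact neg_ne_zero.mpr (mul_ne_zero (two_ne_zero_zmod hp) ht)

theorem exists_locallyTransitive_of_sq (hp : 3 < p) {D : ℤ_[p]} {t : ZMod p} (ht : t ≠ 0)
    (hD : t ^ 2 = PadicInt.toZMod (D - 4)) :
    ∃ v₀ ∈ markoffSet (ZMod p) (PadicInt.toZMod D), LocallyTransitive D v₀ := by
  rw [map_sub, map_ofNat] at hD
  exact ⟨_, mem_markoffSet_two_two hp ht hD, locallyTransitive_two_two hp D ht⟩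

theorem exists_locallyTransitive_of_sq_dvd (hp : 3 < p) {D : ℤ_[p]} (hD : (p : ℤ_[p]) ^ 2 ∣ D) :
    ∃ v₀ ∈ markoffSet (ZMod p) (PadicInt.toZMod D), LocallyTransitive D v₀ := by
  by_cases hsq : ∃ s : ZMod p, s ^ 2 = -1
  · obtain ⟨s, hs⟩ := hsq
    have hs0 : s ≠ 0 := by
      rintro rfl
      norm_num at hs
    apply exists_locallyTransitive_of_sq hp (mul_ne_zero (two_ne_zero_zmod hp) hs0)
    rw [map_sub, map_ofNat,
      (prime_dvd_iff_toZMod_eq_zero D).mp ((dvd_pow_self _ two_ne_zero).trans hD)]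
    linear_combination 4 * hs
  · push Not at hsq
    refine exists_locallyTransitive_of_nonsquare ?_ hD hsq
    have h4 : p ≠ 4 := by
      rintro rfl
      exact absurd (Fact.out : Nat.Prime 4) (by norm_num)
    have h5 : p ≠ 5 := by
      rintro rfl
      exact hsq 2 (by reduce_mod_char)
    omega

theorem markoffSet_mapTriple {D : ℤ_[p]} {a : ℤ_[p] × ℤ_[p] × ℤ_[p]}
    (ha : a ∈ markoffSet ℤ_[p] D) :
    mapTriple PadicInt.toZMod a ∈ markoffSet (ZMod p) (PadicInt.toZMod D) := by
  obtain ⟨h, hu⟩ := ha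
  constructor
  · simp [mapTriple, ← h]
  · simp only [isUnit_iff_toZMod_ne_zero, map_sub, map_mul, map_ofNat] at hu
    simpa only [mapTriple, isUnit_iff_ne_zero] using hu

theorem exists_fullAutGroup_tripleCong {D : ℤ_[p]} {v₀ : ZMod p × ZMod p × ZMod p}
    (hv₀ : v₀ ∈ markoffSet (ZMod p) (PadicInt.toZMod D)) (hloc : LocallyTransitive D v₀)
    (htrans : ∀ a ∈ markoffSet (ZMod p) (PadicInt.toZMod D),
      ∀ b ∈ markoffSet (ZMod p) (PadicInt.toZMod D), ∃ γ ∈ fullAutGroup (ZMod p), γ a = b)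
    {a b : ℤ_[p] × ℤ_[p] × ℤ_[p]} (ha : a ∈ markoffSet ℤ_[p] D) (hb : b ∈ markoffSet ℤ_[p] D)
    (n : ℕ) :
    ∃ γ ∈ fullAutGroup ℤ_[p], TripleCong ((p : ℤ_[p]) ^ (n + 1)) (γ a) b := by
  have move : ∀ c ∈ markoffSet ℤ_[p] D, ∃ γ ∈ fullAutGroup ℤ_[p], markoffPoly (γ c) = D ∧
      mapTriple PadicInt.toZMod (γ c) = v₀ := by
    intro c hc
    obtain ⟨δ, hδ, e⟩ := htrans _ (markoffSet_mapTriple hc) _ hv₀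
    obtain ⟨γ, hγ, h⟩ := exists_fullAutGroup_lift PadicInt.toZMod hδ
    exact ⟨γ, hγ, (markoffPoly_fullAutGroup hγ c).trans hc.1, (h c).trans e⟩
  obtain ⟨γ₁, hγ₁, h₁, e₁⟩ := move a ha
  obtain ⟨γ₂, hγ₂, h₂, e₂⟩ := move b hb
  obtain ⟨γ, hγ, h⟩ := hloc _ _ h₁ h₂ e₁ e₂ n
  refine ⟨γ₂⁻¹ * γ * γ₁, mul_mem (mul_mem (inv_mem hγ₂) hγ) hγ₁, ?_⟩
  simpa using h.apply (inv_mem hγ₂)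

theorem norm_le_of_pow_dvd {n : ℕ} {x : ℤ_[p]} (h : (p : ℤ_[p]) ^ n ∣ x) :
    ‖x‖ ≤ (p : ℝ)⁻¹ ^ n := by
  rw [inv_pow, ← zpow_natCast, ← zpow_neg, PadicInt.norm_le_pow_iff_mem_span_pow,
    Ideal.mem_span_singleton]
  exact h

theorem dist_lt_of_tripleCong {n : ℕ} {u v : ℤ_[p] × ℤ_[p] × ℤ_[p]} {ε : ℝ}
    (h : TripleCong ((p : ℤ_[p]) ^ n) u v) (hε : (p : ℝ)⁻¹ ^ n < ε) : dist u v < ε := by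
  rw [dist_eq_norm, Prod.norm_def, Prod.norm_def, max_lt_iff, max_lt_iff]
  exact ⟨(norm_le_of_pow_dvd h.1).trans_lt hε, (norm_le_of_pow_dvd h.2.1).trans_lt hε,
    (norm_le_of_pow_dvd h.2.2).trans_lt hε⟩

end Minimality

/-- Bourgain–Gamburd–Sarnak type minimality.
If `p > 3` is prime, `D ∈ ℤ_p` has `|D|_p ≤ p⁻²` or `D - 4` reduces to a nonzero square
mod `p`, and the group generated by the Vieta involutions, sign changes and coordinate
permutations acts transitively on `X_{D̄}^*(ℤ/pℤ)`, then the corresponding group over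
`ℤ_p` acts minimally on `X_D^*(ℤ_p)`: every orbit is dense for the sup distance. -/
theorem stmt0 (p : ℕ) [Fact p.Prime] (hp : 3 < p) (D : ℤ_[p])
    (hD : ‖D‖ ≤ ((p : ℝ))⁻¹ ^ 2 ∨
      ∃ t : ZMod p, t ≠ 0 ∧ t ^ 2 = PadicInt.toZMod (D - 4))
    (htrans : ∀ a ∈ markoffSet (ZMod p) (PadicInt.toZMod D),
      ∀ b ∈ markoffSet (ZMod p) (PadicInt.toZMod D),
        ∃ γ ∈ fullAutGroup (ZMod p), γ a = b) :
    ∀ a ∈ markoffSet ℤ_[p] D, ∀ b ∈ markoffSet ℤ_[p] D, ∀ ε > (0 : ℝ),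
      ∃ γ ∈ fullAutGroup ℤ_[p], dist (γ a) b < ε := by
  have hloc : ∃ v₀ ∈ markoffSet (ZMod p) (PadicInt.toZMod D), LocallyTransitive D v₀ := by
    rcases hD with hD | ⟨t, ht, hD⟩
    · apply exists_locallyTransitive_of_sq_dvd hp
      rwa [inv_pow, ← zpow_natCast, ← zpow_neg, PadicInt.norm_le_pow_iff_mem_span_pow,
        Ideal.mem_span_singleton] at hD
    · exact exists_locallyTransitive_of_sq hp ht hD
  obtain ⟨v₀, hv₀, hloc⟩ := hloc
  intro a ha b hb ε hε
  have hp1 : (p : ℝ)⁻¹ < 1 := inv_lt_one_of_one_lt₀ (by exact_mod_cast (by omega : 1 < p))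
  obtain ⟨n, hn⟩ := exists_pow_lt_of_lt_one hε hp1
  obtain ⟨γ, hγ, h⟩ := exists_fullAutGroup_tripleCong hv₀ hloc htrans ha hb n
  exact ⟨γ, hγ, dist_lt_of_tripleCong (h.of_dvd (pow_dvd_pow _ n.le_succ)) hn⟩
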